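/- For all real z > ν ≥ 0, B(z,ν) ≥ A(z,ν); that is, (1/π)(√(z² − ν²) − ν·arccos(ν/z)) + 1/4 ≥ (1/π)(θ(ν,z) + π/2). -/

import Mathlib

open Real MeasureTheory Set Filter intervalIntegral

/-- Integral representation of the modified Bessel function `K₀`. -/
noncomputable def K0 (x : ℝ) : ℝ := ∫ t in Ioi (0:ℝ), Real.exp (-x * Real.cosh t)

/-- Bessel modulus squared, via Nicholson's formula. -/
noncomputable def M2 (ν z : ℝ) : ℝ :=
  (8 / π ^ 2) * ∫ t in Ioi (0:ℝ), K0 (2 * z * Real.sinh t) * Real.cosh (2 * ν * t)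

/-- The Bessel phase. -/
noncomputable def phase (ν z : ℝ) : ℝ :=
  -(π / 2) + (2 / π) * ∫ u in (0:ℝ)..z, 1 / (u * M2 ν u)

/-- `A(z,ν) = (1/π)(θ_ν(z) + π/2)`. -/
noncomputable def A (z ν : ℝ) : ℝ := (1 / π) * (phase ν z + π / 2)

/-- `B(z,ν) = (1/π)(√(z²−ν²) − ν·arccos(ν/z)) + 1/4`. -/
noncomputable def B (z ν : ℝ) : ℝ :=
  (1 / π) * (Real.sqrt (z ^ 2 - ν ^ 2) - ν * Real.arccos (ν / z)) + 1 / 4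

namespace BesselPhase

open scoped Topology

lemma one_add_sq_half_le_cosh {t : ℝ} (ht : 0 ≤ t) : 1 + t ^ 2 / 2 ≤ cosh t := by
  have h1 : cosh t = 1 + 2 * sinh (t / 2) ^ 2 := by
    have := Real.cosh_two_mul (t / 2)
    rw [Real.cosh_sq, mul_div_cancel₀ t two_ne_zero] at this
    linarith
  have h2 : t / 2 ≤ sinh (t / 2) := Real.self_le_sinh_iff.2 (by linarith)
  nlinarith

lemma cosh_sub_one_le_sinh {t : ℝ} (ht : 0 ≤ t) : cosh t - 1 ≤ sinh t := by
  have h1 := Real.cosh_sub_sinh t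
  have h2 : exp (-t) ≤ 1 := Real.exp_le_one_iff.2 (by linarith)
  linarith

lemma sq_half_le_sinh {t : ℝ} (ht : 0 ≤ t) : t ^ 2 / 2 ≤ sinh t := by
  linarith [one_add_sq_half_le_cosh ht, cosh_sub_one_le_sinh ht]

lemma cosh_le_exp_self {t : ℝ} (ht : 0 ≤ t) : cosh t ≤ exp t := by
  have h1 := Real.cosh_add_sinh t
  have h2 := Real.sinh_nonneg_iff.2 ht
  linarith

lemma cosh_mul_le_exp {a t : ℝ} : cosh (a * t) ≤ exp (|a| * |t|) := by
  rw [← abs_mul, ← Real.cosh_abs]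
  exact cosh_le_exp_self (abs_nonneg _)

lemma exp_linear_sub_sq_le {x b t : ℝ} (hx : 0 < x) :
    exp (b * t - x * (t ^ 2 / 2)) ≤ exp ((b + 1) ^ 2 / (2 * x)) * exp (-t) := by
  rw [← Real.exp_add, Real.exp_le_exp]
  have : (b + 1) ^ 2 / (2 * x) = (b + 1) ^ 2 / x / 2 := by field_simp
  rw [this]
  have h : (b + 1) ^ 2 / x + x * t ^ 2 - 2 * (b + 1) * t = ((b + 1) - x * t) ^ 2 / x := by
    field_simp; ring
  have h' : 0 ≤ ((b + 1) - x * t) ^ 2 / x := by positivity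
  linarith

/-- The moments `∫ coshʲ t · exp (-x cosh t) dt` of the kernel defining `K₀`. -/
noncomputable def coshMoment (j : ℕ) (x : ℝ) : ℝ :=
  ∫ t in Ioi (0 : ℝ), cosh t ^ j * exp (-x * cosh t)

lemma coshMoment_zero (x : ℝ) : coshMoment 0 x = K0 x := by
  simp [coshMoment, K0]

lemma coshMoment_kernel_le {x : ℝ} (hx : 0 < x) (j : ℕ) {t : ℝ} (ht : 0 ≤ t) :
    cosh t ^ j * exp (-x * cosh t) ≤ exp (((j : ℝ) + 1) ^ 2 / (2 * x)) * exp (-t) := by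
  refine le_trans ?_ (exp_linear_sub_sq_le hx)
  have h1 : cosh t ^ j ≤ exp (j * t) := by
    rw [Real.exp_nat_mul]
    exact pow_le_pow_left₀ (Real.cosh_pos t).le (cosh_le_exp_self ht) j
  rw [sub_eq_add_neg, Real.exp_add]
  gcongr
  nlinarith [one_add_sq_half_le_cosh ht]

lemma integrableOn_exp_neg : IntegrableOn (fun t : ℝ => exp (-t)) (Ioi 0) := by
  simpa using integrableOn_exp_neg_Ioi 0

lemma coshMoment_kernel_integrable {x : ℝ} (hx : 0 < x) (j : ℕ) :
    IntegrableOn (fun t => cosh t ^ j * exp (-x * cosh t)) (Ioi 0) := by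
  refine Integrable.mono' (integrableOn_exp_neg.const_mul (exp (((j : ℝ) + 1) ^ 2 / (2 * x))))
    (by fun_prop) ?_
  filter_upwards [ae_restrict_mem measurableSet_Ioi] with t ht
  rw [Real.norm_of_nonneg (by have := Real.cosh_pos t; positivity)]
  exact coshMoment_kernel_le hx j (le_of_lt ht)

lemma hasDerivAt_coshMoment {x : ℝ} (hx : 0 < x) (j : ℕ) :
    HasDerivAt (coshMoment j) (-coshMoment (j + 1) x) x := by
  have h := (hasDerivAt_integral_of_dominated_loc_of_deriv_le (μ := volume.restrict (Ioi (0:ℝ)))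
    (F := fun x t => cosh t ^ j * exp (-x * cosh t))
    (F' := fun x t => -(cosh t ^ (j + 1) * exp (-x * cosh t))) (x₀ := x)
    (bound := fun t => exp ((((j + 1 : ℕ) : ℝ) + 1) ^ 2 / (2 * (x / 2))) * exp (-t))
    (s := Ioi (x / 2)) (Ioi_mem_nhds (by linarith)) (Eventually.of_forall fun _ => by fun_prop)
    (coshMoment_kernel_integrable hx j) (by fun_prop) ?_
    (integrableOn_exp_neg.const_mul _) ?_).2
  · rw [MeasureTheory.integral_neg] at h
    exact h
  · filter_upwards [ae_restrict_mem measurableSet_Ioi] with t ht y hy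
    have hc := Real.cosh_pos t
    rw [norm_neg, Real.norm_of_nonneg (by positivity)]
    refine le_trans ?_ (coshMoment_kernel_le (half_pos hx) (j + 1) (le_of_lt ht))
    have : x / 2 < y := hy
    gcongr
  · refine Eventually.of_forall fun t y _ => ?_
    have : HasDerivAt (fun y : ℝ => -y * cosh t) (-1 * cosh t) y :=
      (hasDerivAt_id y).neg.mul_const _
    exact (this.exp.const_mul (cosh t ^ j)).congr_deriv (by ring)

lemma coshMoment_one_eq {x : ℝ} (hx : 0 < x) :
    coshMoment 1 x = x * (coshMoment 2 x - coshMoment 0 x) := by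
  have i0 := coshMoment_kernel_integrable hx 0
  have i1 := coshMoment_kernel_integrable hx 1
  have i2 := coshMoment_kernel_integrable hx 2
  have h := integral_Ioi_of_hasDerivAt_of_tendsto' (a := 0) (m := 0)
    (f := fun t => sinh t * exp (-x * cosh t))
    (f' := fun t => cosh t ^ 1 * exp (-x * cosh t) -
      x * (cosh t ^ 2 * exp (-x * cosh t) - cosh t ^ 0 * exp (-x * cosh t))) ?_
      (i1.sub ((i2.sub i0).const_mul x)) ?_
  · have e1 := MeasureTheory.integral_sub i1 ((i2.sub i0).const_mul x)
    have e2 := MeasureTheory.integral_sub i2 i0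
    simp only [Pi.sub_apply] at e1
    rw [e1, MeasureTheory.integral_const_mul, e2] at h
    simp only [Real.sinh_zero, zero_mul, sub_zero] at h
    unfold coshMoment
    linarith
  · intro t _
    refine ((Real.hasDerivAt_sinh t).mul
      ((Real.hasDerivAt_cosh t).const_mul (-x)).exp).congr_deriv ?_
    have := Real.cosh_sq t
    rw [this]; ring
  · have ht : Tendsto (fun t : ℝ => exp (((1 : ℕ) + 1 : ℝ) ^ 2 / (2 * x)) * exp (-t)) atTop (𝓝 0) := by
      simpa using Real.tendsto_exp_neg_atTop_nhds_zero.const_mul (exp (((1 : ℕ) + 1 : ℝ) ^ 2 / (2 * x)))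
    refine squeeze_zero' ?_ ?_ ht
    · filter_upwards [eventually_ge_atTop 0] with t h0
      have := Real.sinh_nonneg_iff.2 h0
      positivity
    · filter_upwards [eventually_ge_atTop 0] with t h0
      refine le_trans ?_ (coshMoment_kernel_le hx 1 h0)
      have := (Real.sinh_lt_cosh t).le
      rw [pow_one]; gcongr

/-- The modified Bessel function `K₁ = -K₀'`. -/
noncomputable def K1 (x : ℝ) : ℝ := coshMoment 1 x

lemma hasDerivAt_K0 {x : ℝ} (hx : 0 < x) : HasDerivAt K0 (-K1 x) x := by
  have : K0 = coshMoment 0 := by funext y; rw [coshMoment_zero]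
  rw [this]
  exact hasDerivAt_coshMoment hx 0

lemma hasDerivAt_K1 {x : ℝ} (hx : 0 < x) : HasDerivAt K1 (-K0 x - K1 x / x) x := by
  refine (hasDerivAt_coshMoment hx 1).congr_deriv ?_
  have h := coshMoment_one_eq hx
  have : K1 x / x = coshMoment 2 x - K0 x := by
    rw [K1, h, coshMoment_zero]; field_simp
  rw [this]; ring

lemma K0_pos {x : ℝ} (hx : 0 < x) : 0 < K0 x := by
  rw [← coshMoment_zero]
  refine (setIntegral_pos_iff_support_of_nonneg_ae (Eventually.of_forall fun t => ?_)
    (coshMoment_kernel_integrable hx 0)).2 ?_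
  · have := Real.cosh_pos t
    simp only [Pi.zero_apply]; positivity
  · have : Function.support (fun t => cosh t ^ 0 * exp (-x * cosh t)) = univ := by
      ext t; simp
    rw [this]; simp

lemma K1_nonneg (x : ℝ) : 0 ≤ K1 x :=
  setIntegral_nonneg measurableSet_Ioi fun t _ => by
    have := Real.cosh_pos t
    positivity

lemma K0_le {x : ℝ} (hx : 0 < x) : K0 x ≤ 2 * ((√x)⁻¹ * exp (-x)) := by
  have hg : IntegrableOn (fun t : ℝ => exp (-(x / 2) * t ^ 2)) (Ioi 0) :=
    (integrable_exp_neg_mul_sq (half_pos hx)).integrableOn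
  have h1 : K0 x ≤ ∫ t in Ioi (0 : ℝ), exp (-x) * exp (-(x / 2) * t ^ 2) := by
    refine setIntegral_mono_on ?_ (hg.const_mul _) measurableSet_Ioi fun t ht => ?_
    · simpa using coshMoment_kernel_integrable hx 0
    · rw [← Real.exp_add, Real.exp_le_exp]
      nlinarith [one_add_sq_half_le_cosh (le_of_lt ht : (0 : ℝ) ≤ t)]
  rw [MeasureTheory.integral_const_mul, integral_gaussian_Ioi] at h1
  refine h1.trans ?_
  have h2 : √(π / (x / 2)) / 2 ≤ 2 * (√x)⁻¹ := by
    have h3 : √(π / (x / 2)) ≤ √(16 / x) := by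
      apply Real.sqrt_le_sqrt
      rw [div_div_eq_mul_div]
      gcongr
      linarith [Real.pi_le_four]
    have h4 : √(16 / x) = 4 * (√x)⁻¹ := by
      rw [Real.sqrt_div (by norm_num), show (16 : ℝ) = 4 ^ 2 by norm_num,
        Real.sqrt_sq (by norm_num)]
      rfl
    linarith
  calc exp (-x) * (√(π / (x / 2)) / 2) ≤ exp (-x) * (2 * (√x)⁻¹) := by gcongr
    _ = _ := by ring

lemma mul_K1_le {x : ℝ} (hx : 0 < x) : x * K1 x ≤ exp (-x) + x * K0 x := by
  have i0 := coshMoment_kernel_integrable hx 0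
  have i1 := coshMoment_kernel_integrable hx 1
  have hs : ∫ t in Ioi (0 : ℝ), x * sinh t * exp (-x * cosh t) = exp (-x) := by
    have hint : IntegrableOn (fun t => x * sinh t * exp (-x * cosh t)) (Ioi 0) := by
      refine Integrable.mono' (i1.const_mul x) (by fun_prop) ?_
      filter_upwards [ae_restrict_mem measurableSet_Ioi] with t ht
      have h0 := Real.sinh_nonneg_iff.2 (le_of_lt ht : (0 : ℝ) ≤ t)
      have := (Real.sinh_lt_cosh t).le
      rw [Real.norm_of_nonneg (by positivity), pow_one, mul_assoc]
      gcongr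
    have h := integral_Ioi_of_hasDerivAt_of_tendsto' (a := 0) (m := 0)
      (f := fun t => -exp (-x * cosh t)) (f' := fun t => x * sinh t * exp (-x * cosh t)) ?_ hint ?_
    · simpa using h
    · intro t _
      exact (((Real.hasDerivAt_cosh t).const_mul (-x)).exp.neg).congr_deriv (by ring)
    · rw [← neg_zero]
      refine Tendsto.neg ?_
      have ht : Tendsto (fun t : ℝ => exp ((((0 : ℕ) : ℝ) + 1) ^ 2 / (2 * x)) * exp (-t)) atTop
          (𝓝 0) := by
        simpa only [mul_zero] using
          Real.tendsto_exp_neg_atTop_nhds_zero.const_mul (exp ((((0 : ℕ) : ℝ) + 1) ^ 2 / (2 * x)))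
      refine squeeze_zero' (Eventually.of_forall fun t => (exp_pos _).le) ?_ ht
      filter_upwards [eventually_ge_atTop 0] with t h0
      simpa using coshMoment_kernel_le hx 0 h0
  have hint : IntegrableOn (fun t => x * sinh t * exp (-x * cosh t)) (Ioi 0) := by
    by_contra hcon
    rw [integral_undef hcon] at hs
    exact (exp_pos _).ne hs
  rw [← hs, ← coshMoment_zero, K1, coshMoment, coshMoment, ← MeasureTheory.integral_const_mul,
    ← MeasureTheory.integral_const_mul, ← MeasureTheory.integral_add hint (i0.const_mul x)]
  refine setIntegral_mono_on (i1.const_mul x) (hint.add (i0.const_mul x)) measurableSet_Ioi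
    fun t ht => ?_
  have h0 := cosh_sub_one_le_sinh (le_of_lt ht : (0 : ℝ) ≤ t)
  have : x * (sinh t - (cosh t - 1)) * exp (-x * cosh t) ≥ 0 :=
    mul_nonneg (mul_nonneg hx.le (by linarith)) (exp_pos _).le
  simp only [pow_one, pow_zero, one_mul]
  linarith

/-- Functions on `(0, ∞)` with at most an inverse-square-root singularity at `0` and exponential
decay at `∞`. -/
def Decaying (f : ℝ → ℝ) : Prop :=
  ∃ M, 0 ≤ M ∧ ∀ y, 0 < y → |f y| ≤ M * ((√y)⁻¹ * exp (-y / 2))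

lemma Decaying.add {f g : ℝ → ℝ} (hf : Decaying f) (hg : Decaying g) :
    Decaying fun y => f y + g y := by
  obtain ⟨M, hM, h⟩ := hf
  obtain ⟨N, hN, h'⟩ := hg
  refine ⟨M + N, by positivity, fun y hy => (abs_add_le _ _).trans ?_⟩
  rw [add_mul]
  exact add_le_add (h y hy) (h' y hy)

lemma Decaying.const_mul {f : ℝ → ℝ} (hf : Decaying f) (c : ℝ) : Decaying fun y => c * f y := by
  obtain ⟨M, hM, h⟩ := hf
  refine ⟨|c| * M, by positivity, fun y hy => ?_⟩
  rw [abs_mul, mul_assoc]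
  exact mul_le_mul_of_nonneg_left (h y hy) (abs_nonneg c)

lemma pow_mul_exp_neg_le {y : ℝ} (hy : 0 < y) (k : ℕ) :
    y ^ k * exp (-y) ≤ (2 ^ k * k.factorial) * exp (-y / 2) := by
  have h := Real.pow_div_factorial_le_exp (y / 2) (by positivity) k
  rw [div_le_iff₀ (by positivity), div_pow, div_le_iff₀ (by positivity)] at h
  calc y ^ k * exp (-y) ≤ (exp (y / 2) * k.factorial * 2 ^ k) * exp (-y) := by gcongr
    _ = (2 ^ k * k.factorial) * (exp (y / 2) * exp (-y)) := by ring
    _ = _ := by rw [← Real.exp_add]; ring_nf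

lemma decaying_pow_mul_K0 (k : ℕ) : Decaying fun y => y ^ k * K0 y := by
  refine ⟨2 * (2 ^ k * k.factorial), by positivity, fun y hy => ?_⟩
  rw [abs_of_nonneg (by have := K0_pos hy; positivity)]
  calc y ^ k * K0 y ≤ y ^ k * (2 * ((√y)⁻¹ * exp (-y))) := by gcongr; exact K0_le hy
    _ = 2 * (√y)⁻¹ * (y ^ k * exp (-y)) := by ring
    _ ≤ 2 * (√y)⁻¹ * ((2 ^ k * k.factorial) * exp (-y / 2)) :=
      mul_le_mul_of_nonneg_left (pow_mul_exp_neg_le hy k) (by positivity)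
    _ = _ := by ring

lemma decaying_pow_mul_exp (k : ℕ) : Decaying fun y => y ^ k * exp (-y) := by
  refine ⟨2 ^ k * k.factorial + 2 ^ (k + 1) * (k + 1).factorial, by positivity, fun y hy => ?_⟩
  rw [abs_of_nonneg (by positivity)]
  have h1 := pow_mul_exp_neg_le hy k
  have h2 := pow_mul_exp_neg_le hy (k + 1)
  have hs : 0 < √y := Real.sqrt_pos.2 hy
  have h3 : √y ≤ 1 + y := by nlinarith [Real.sq_sqrt hy.le, sq_nonneg (√y - 1)]
  calc y ^ k * exp (-y) = (√y)⁻¹ * (√y * (y ^ k * exp (-y))) := by field_simp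
    _ ≤ (√y)⁻¹ * ((1 + y) * (y ^ k * exp (-y))) := by gcongr
    _ = (√y)⁻¹ * (y ^ k * exp (-y) + y ^ (k + 1) * exp (-y)) := by ring
    _ ≤ (√y)⁻¹ * ((2 ^ k * k.factorial) * exp (-y / 2) +
        (2 ^ (k + 1) * (k + 1).factorial) * exp (-y / 2)) := by gcongr
    _ = _ := by ring

lemma decaying_pow_mul_K1 (k : ℕ) : Decaying fun y => y ^ (k + 1) * K1 y := by
  obtain ⟨M, hM, h⟩ := (decaying_pow_mul_exp k).add (decaying_pow_mul_K0 (k + 1))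
  refine ⟨M, hM, fun y hy => le_trans ?_ (h y hy)⟩
  have hK := K0_pos hy
  rw [abs_of_nonneg (mul_nonneg (by positivity) (K1_nonneg y)), abs_of_nonneg (by positivity)]
  calc y ^ (k + 1) * K1 y = y ^ k * (y * K1 y) := by ring
    _ ≤ y ^ k * (exp (-y) + y * K0 y) := by gcongr; exact mul_K1_le hy
    _ = _ := by ring

lemma integrableOn_inv_sqrt_mul_exp_neg :
    IntegrableOn (fun t : ℝ => (√t)⁻¹ * exp (-t)) (Ioi 0) := by
  refine (Real.GammaIntegral_convergent (s := 1 / 2) (by norm_num)).congr_fun (fun t ht => ?_)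
    measurableSet_Ioi
  have ht : (0 : ℝ) < t := ht
  simp only
  rw [mul_comm, Real.sqrt_eq_rpow, ← Real.rpow_neg ht.le]
  norm_num

/-- Functions on `(0, ∞)` of at most exponential growth, vanishing to order `m` at `0`. -/
def ExpBounded (m : ℕ) (w : ℝ → ℝ) : Prop :=
  ∃ C b, 0 ≤ C ∧ 0 ≤ b ∧ ∀ t, 0 < t → |w t| ≤ C * (t ^ m * exp (b * t))

lemma ExpBounded.add {m : ℕ} {v w : ℝ → ℝ} (hv : ExpBounded m v) (hw : ExpBounded m w) :
    ExpBounded m fun t => v t + w t := by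
  obtain ⟨C, b, hC, hb, h⟩ := hv
  obtain ⟨D, c, hD, hc, h'⟩ := hw
  refine ⟨C + D, b + c, by positivity, by positivity, fun t ht => (abs_add_le _ _).trans ?_⟩
  rw [add_mul]
  refine add_le_add ((h t ht).trans ?_) ((h' t ht).trans ?_)
  · gcongr; linarith
  · gcongr; linarith

lemma ExpBounded.mul {m n : ℕ} {v w : ℝ → ℝ} (hv : ExpBounded m v) (hw : ExpBounded n w) :
    ExpBounded (m + n) fun t => v t * w t := by
  obtain ⟨C, b, hC, hb, h⟩ := hv
  obtain ⟨D, c, hD, hc, h'⟩ := hw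
  refine ⟨C * D, b + c, by positivity, by positivity, fun t ht => ?_⟩
  rw [abs_mul]
  calc |v t| * |w t| ≤ (C * (t ^ m * exp (b * t))) * (D * (t ^ n * exp (c * t))) :=
        mul_le_mul (h t ht) (h' t ht) (abs_nonneg _) (by positivity)
    _ = _ := by rw [add_mul, Real.exp_add, pow_add]; ring

lemma expBounded_const (c : ℝ) : ExpBounded 0 fun _ => c :=
  ⟨|c|, 0, abs_nonneg c, le_rfl, fun t _ => by simp⟩

lemma expBounded_cosh (a : ℝ) : ExpBounded 0 fun t => cosh (a * t) :=
  ⟨1, |a|, zero_le_one, abs_nonneg a, fun t ht => by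
    rw [abs_of_pos (Real.cosh_pos _)]
    simpa [abs_of_pos ht] using cosh_mul_le_exp (a := a) (t := t)⟩

lemma expBounded_inv_cosh : ExpBounded 0 fun t => (cosh t)⁻¹ :=
  ⟨1, 0, zero_le_one, le_rfl, fun t _ => by
    rw [abs_of_pos (inv_pos.2 (Real.cosh_pos _))]
    simpa using inv_le_one_of_one_le₀ (Real.one_le_cosh t)⟩

lemma sinh_le_mul_exp {u : ℝ} : sinh u ≤ u * exp u := by
  have h1 := Real.add_one_le_exp (-(2 * u))
  have h2 : exp (-(2 * u)) * exp u = exp (-u) := by rw [← Real.exp_add]; ring_nf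
  rw [Real.sinh_eq]
  nlinarith [exp_pos u]

lemma expBounded_sinh (a : ℝ) : ExpBounded 1 fun t => sinh (a * t) := by
  refine ⟨|a|, |a|, abs_nonneg a, abs_nonneg a, fun t ht => ?_⟩
  have h : |sinh (a * t)| = sinh (|a| * t) := by
    rw [Real.abs_sinh, abs_mul, abs_of_pos ht]
  rw [h]
  refine sinh_le_mul_exp.trans (le_of_eq ?_)
  ring

lemma Decaying.kernel_le {f : ℝ → ℝ} (hf : Decaying f) {x₀ : ℝ} (hx₀ : 0 < x₀) (b : ℝ) :
    ∃ M, 0 ≤ M ∧ ∀ x, x₀ ≤ x → ∀ t, 0 < t →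
      |f (2 * x * sinh t)| * exp (b * t) ≤ M * ((√t)⁻¹ * exp (-t)) := by
  obtain ⟨M, hM, h⟩ := hf
  refine ⟨M * (√(2 * x₀))⁻¹ * exp ((b + 1) ^ 2 / (2 * x₀)), by positivity, fun x hx t ht => ?_⟩
  have hxp : 0 < x := hx₀.trans_le hx
  have hs : t ≤ sinh t := Real.self_le_sinh_iff.2 ht.le
  have hs0 : 0 < sinh t := ht.trans_le hs
  have h1 := h (2 * x * sinh t) (by positivity)
  have h2 : (√(2 * x * sinh t))⁻¹ ≤ (√(2 * x₀))⁻¹ * (√t)⁻¹ := by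
    rw [← mul_inv, ← Real.sqrt_mul (by positivity)]
    gcongr
  have h3 : exp (-(2 * x * sinh t) / 2) * exp (b * t) ≤
      exp ((b + 1) ^ 2 / (2 * x₀)) * exp (-t) := by
    refine le_trans ?_ (exp_linear_sub_sq_le hx₀)
    rw [← Real.exp_add, Real.exp_le_exp]
    have := sq_half_le_sinh ht.le
    have : x₀ * (t ^ 2 / 2) ≤ x * sinh t := mul_le_mul hx this (by positivity) hxp.le
    linarith
  calc |f (2 * x * sinh t)| * exp (b * t)
      ≤ M * ((√(2 * x * sinh t))⁻¹ * exp (-(2 * x * sinh t) / 2)) * exp (b * t) := by gcongr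
    _ = M * (√(2 * x * sinh t))⁻¹ * (exp (-(2 * x * sinh t) / 2) * exp (b * t)) := by ring
    _ ≤ M * ((√(2 * x₀))⁻¹ * (√t)⁻¹) * (exp ((b + 1) ^ 2 / (2 * x₀)) * exp (-t)) := by gcongr
    _ = _ := by ring

lemma Decaying.mul_weight_le {f w : ℝ → ℝ} (hf : Decaying f) {m : ℕ} (hw : ExpBounded m w)
    {x₀ : ℝ} (hx₀ : 0 < x₀) :
    ∃ M, 0 ≤ M ∧ ∀ x, x₀ ≤ x → ∀ t, 0 < t →
      |f (2 * x * sinh t) * w t| ≤ M * (t ^ m * ((√t)⁻¹ * exp (-t))) := by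
  obtain ⟨C, b, hC, hb, h⟩ := hw
  obtain ⟨M, hM, h'⟩ := hf.kernel_le hx₀ b
  refine ⟨C * M, by positivity, fun x hx t ht => ?_⟩
  rw [abs_mul]
  calc |f (2 * x * sinh t)| * |w t| ≤ |f (2 * x * sinh t)| * (C * (t ^ m * exp (b * t))) := by
        gcongr; exact h t ht
    _ = C * t ^ m * (|f (2 * x * sinh t)| * exp (b * t)) := by ring
    _ ≤ C * t ^ m * (M * ((√t)⁻¹ * exp (-t))) :=
        mul_le_mul_of_nonneg_left (h' x hx t ht) (by positivity)
    _ = _ := by ring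

lemma continuousOn_comp_sinh {f : ℝ → ℝ} (hc : ContinuousOn f (Ioi 0)) {x : ℝ} (hx : 0 < x) :
    ContinuousOn (fun t => f (2 * x * sinh t)) (Ioi 0) := by
  refine hc.comp (by fun_prop) fun t ht => ?_
  have : 0 < sinh t := Real.sinh_pos_iff.2 ht
  simp only [mem_Ioi]; positivity

lemma Decaying.integrable {f w : ℝ → ℝ} (hf : Decaying f) (hc : ContinuousOn f (Ioi 0))
    (hw : ExpBounded 0 w) (hwc : Continuous w) {x : ℝ} (hx : 0 < x) :
    IntegrableOn (fun t => f (2 * x * sinh t) * w t) (Ioi 0) := by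
  obtain ⟨M, hM, h⟩ := hf.mul_weight_le hw hx
  refine Integrable.mono' (integrableOn_inv_sqrt_mul_exp_neg.const_mul M) ?_ ?_
  · exact ((continuousOn_comp_sinh hc hx).mul hwc.continuousOn).aestronglyMeasurable
      measurableSet_Ioi
  · filter_upwards [ae_restrict_mem measurableSet_Ioi] with t ht
    simpa using h x le_rfl t ht

lemma Decaying.tendsto_ends {f w : ℝ → ℝ} (hf : Decaying f) (hw : ExpBounded 1 w) {x : ℝ}
    (hx : 0 < x) :
    Tendsto (fun t => f (2 * x * sinh t) * w t) (𝓝[>] 0) (𝓝 0) ∧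
      Tendsto (fun t => f (2 * x * sinh t) * w t) atTop (𝓝 0) := by
  obtain ⟨M, hM, h⟩ := hf.mul_weight_le hw hx
  have h' : ∀ t, 0 < t → |f (2 * x * sinh t) * w t| ≤ M * (√t * exp (-t)) := fun t ht => by
    refine (h x le_rfl t ht).trans (le_of_eq ?_)
    have : 0 < √t := Real.sqrt_pos.2 ht
    have h2 := Real.sq_sqrt ht.le
    field_simp
    rw [h2]
  constructor
  · refine squeeze_zero_norm' (a := fun t => M * (√t * exp (-t))) ?_ ?_
    · filter_upwards [self_mem_nhdsWithin] with t ht using h' t ht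
    · refine Tendsto.mono_left ?_ nhdsWithin_le_nhds
      have : Continuous fun t : ℝ => M * (√t * exp (-t)) := by fun_prop
      simpa using this.tendsto 0
  · refine squeeze_zero_norm' (a := fun t => M * (exp (-t / 2) * 2)) ?_ ?_
    · filter_upwards [eventually_gt_atTop 0] with t ht
      refine (h' t ht).trans ?_
      have h1 : √t ≤ exp (t / 2) * 2 := by
        have h2 := Real.add_one_le_exp (t / 2)
        nlinarith [Real.sq_sqrt ht.le, sq_nonneg (√t - 1)]
      calc M * (√t * exp (-t)) ≤ M * ((exp (t / 2) * 2) * exp (-t)) := by gcongr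
        _ = M * ((exp (t / 2) * exp (-t)) * 2) := by ring
        _ = _ := by rw [← Real.exp_add]; ring_nf
    · have h3 : Tendsto (fun t : ℝ => exp (-t / 2)) atTop (𝓝 0) := by
        have : Tendsto (fun t : ℝ => t / 2) atTop atTop := tendsto_id.atTop_div_const two_pos
        simpa [Function.comp_def, neg_div] using Real.tendsto_exp_neg_atTop_nhds_zero.comp this
      simpa using (h3.mul_const 2).const_mul M

lemma integral_Ioi_deriv_eq_zero {F F' : ℝ → ℝ} (h0 : F 0 = 0)
    (hd : ∀ t, 0 < t → HasDerivAt F (F' t) t) (hi : IntegrableOn F' (Ioi 0))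
    (hl : Tendsto F (𝓝[>] 0) (𝓝 0) ∧ Tendsto F atTop (𝓝 0)) :
    ∫ t in Ioi (0 : ℝ), F' t = 0 := by
  have hc : ContinuousWithinAt F (Ici 0) 0 := by
    rw [← continuousWithinAt_Ioi_iff_Ici, ContinuousWithinAt, h0]
    exact hl.1
  simpa [h0] using integral_Ioi_of_hasDerivAt_of_tendsto hc (fun t ht => hd t ht) hi hl.2

/-- Nicholson-type integrals, in the logarithmic variable `s = log x`. -/
noncomputable def nicholson (f : ℝ → ℝ) (ν s : ℝ) : ℝ :=
  ∫ t in Ioi (0 : ℝ), f (2 * exp s * sinh t) * cosh (2 * ν * t)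

lemma Decaying.integrable_nicholson {f : ℝ → ℝ} (hf : Decaying f) (hc : ContinuousOn f (Ioi 0))
    (ν s : ℝ) :
    IntegrableOn (fun t => f (2 * exp s * sinh t) * cosh (2 * ν * t)) (Ioi 0) :=
  hf.integrable hc (expBounded_cosh _) (by fun_prop) (exp_pos s)

lemma hasDerivAt_nicholson {f f' g : ℝ → ℝ} (hf : Decaying f) (hg : Decaying g)
    (hd : ∀ y, 0 < y → HasDerivAt f (f' y) y) (hfg : ∀ y, 0 < y → y * f' y = g y)
    (hgc : ContinuousOn g (Ioi 0)) (ν s : ℝ) :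
    HasDerivAt (nicholson f ν) (nicholson g ν s) s := by
  have hfc : ContinuousOn f (Ioi 0) := fun y hy => (hd y hy).continuousAt.continuousWithinAt
  obtain ⟨M, hM, h⟩ := hg.mul_weight_le (expBounded_cosh (2 * ν)) (exp_pos (s - 1))
  refine (hasDerivAt_integral_of_dominated_loc_of_deriv_le (μ := volume.restrict (Ioi (0:ℝ)))
    (F := fun s t => f (2 * exp s * sinh t) * cosh (2 * ν * t))
    (F' := fun s t => g (2 * exp s * sinh t) * cosh (2 * ν * t)) (x₀ := s)
    (bound := fun t => M * (t ^ 0 * ((√t)⁻¹ * exp (-t)))) (s := Ioi (s - 1))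
    (Ioi_mem_nhds (by linarith))
    (Eventually.of_forall fun s => (hf.integrable_nicholson hfc ν s).aestronglyMeasurable)
    (hf.integrable_nicholson hfc ν s) (hg.integrable_nicholson hgc ν s).aestronglyMeasurable ?_
    (by simpa using integrableOn_inv_sqrt_mul_exp_neg.const_mul M) ?_).2
  · filter_upwards [ae_restrict_mem measurableSet_Ioi] with t ht r hr
    exact h _ (Real.exp_le_exp.2 (le_of_lt hr)) t ht
  · filter_upwards [ae_restrict_mem measurableSet_Ioi] with t ht r _
    have hs : 0 < sinh t := Real.sinh_pos_iff.2 ht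
    have hy : 0 < 2 * exp r * sinh t := by positivity
    have h1 : HasDerivAt (fun r => 2 * exp r * sinh t) (2 * exp r * sinh t) r :=
      ((Real.hasDerivAt_exp r).const_mul 2).mul_const _
    refine (((hd _ hy).comp r h1).mul_const (cosh (2 * ν * t))).congr_deriv ?_
    rw [← hfg _ hy]; ring

lemma tendsto_nicholson_atTop {f : ℝ → ℝ} (hf : Decaying f) (hc : ContinuousOn f (Ioi 0)) (ν : ℝ) :
    Tendsto (nicholson f ν) atTop (𝓝 0) := by
  obtain ⟨M, hM, h⟩ := hf.mul_weight_le (expBounded_cosh (2 * ν)) one_pos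
  obtain ⟨N, hN, h'⟩ := hf
  have hz : ∫ t in Ioi (0 : ℝ), (0 : ℝ) = 0 := by simp
  rw [← hz]
  refine tendsto_integral_filter_of_dominated_convergence
    (fun t => M * (t ^ 0 * ((√t)⁻¹ * exp (-t))))
    (Eventually.of_forall fun s =>
      (Decaying.integrable_nicholson ⟨N, hN, h'⟩ hc ν s).aestronglyMeasurable) ?_
    (by simpa using integrableOn_inv_sqrt_mul_exp_neg.const_mul M) ?_
  · filter_upwards [eventually_ge_atTop 0] with s hs
    filter_upwards [ae_restrict_mem measurableSet_Ioi] with t ht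
    exact h _ (Real.one_le_exp hs) t ht
  · filter_upwards [ae_restrict_mem measurableSet_Ioi] with t ht
    have hs : 0 < sinh t := Real.sinh_pos_iff.2 ht
    have hy : Tendsto (fun s => 2 * exp s * sinh t) atTop atTop :=
      (Real.tendsto_exp_atTop.const_mul_atTop two_pos).atTop_mul_const hs
    have hlim : Tendsto f atTop (𝓝 0) := by
      refine squeeze_zero_norm' (a := fun y => N * ((√y)⁻¹ * exp (-y / 2))) ?_ ?_
      · filter_upwards [eventually_gt_atTop 0] with y hy using h' y hy
      · have h3 : Tendsto (fun t : ℝ => exp (-t / 2)) atTop (𝓝 0) := by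
          have : Tendsto (fun t : ℝ => t / 2) atTop atTop := tendsto_id.atTop_div_const two_pos
          simpa [Function.comp_def, neg_div] using Real.tendsto_exp_neg_atTop_nhds_zero.comp this
        simpa using ((tendsto_inv_atTop_zero.comp Real.tendsto_sqrt_atTop).mul h3).const_mul N
    simpa using (hlim.comp hy).mul_const (cosh (2 * ν * t))

lemma expBounded_sinh_self : ExpBounded 1 sinh := by
  simpa using expBounded_sinh 1

lemma expBounded_zero_sinh (a : ℝ) : ExpBounded 0 fun t => sinh (a * t) := by
  obtain ⟨C, b, hC, hb, h⟩ := expBounded_cosh a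
  refine ⟨C, b, hC, hb, fun t ht => le_trans ?_ (h t ht)⟩
  rw [Real.abs_sinh, abs_of_pos (Real.cosh_pos _), ← Real.cosh_abs]
  exact (Real.sinh_lt_cosh _).le

lemma expBounded_zero_sinh_self : ExpBounded 0 sinh := by
  simpa using expBounded_zero_sinh 1

lemma expBounded_cosh_self : ExpBounded 0 cosh := by
  simpa using expBounded_cosh 1

/-- The first Euler derivative `y K₀'(y)`. -/
noncomputable def eulerK0 (y : ℝ) : ℝ := -(y * K1 y)

/-- The second Euler derivative of `K₀`, equal to `y² K₀(y)`. -/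
noncomputable def eulerK0₂ (y : ℝ) : ℝ := y ^ 2 * K0 y

/-- The third Euler derivative of `K₀`. -/
noncomputable def eulerK0₃ (y : ℝ) : ℝ := 2 * (y ^ 2 * K0 y) + -1 * (y ^ 3 * K1 y)

lemma decaying_K0 : Decaying K0 := by simpa using decaying_pow_mul_K0 0

lemma decaying_eulerK0 : Decaying eulerK0 := by
  have h := (decaying_pow_mul_K1 0).const_mul (-1)
  have : eulerK0 = fun y => -1 * (y ^ (0 + 1) * K1 y) := by funext y; simp [eulerK0]
  rwa [this]

lemma decaying_eulerK0₂ : Decaying eulerK0₂ := decaying_pow_mul_K0 2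

lemma decaying_eulerK0₃ : Decaying eulerK0₃ :=
  ((decaying_pow_mul_K0 2).const_mul 2).add ((decaying_pow_mul_K1 2).const_mul (-1))

lemma hasDerivAt_eulerK0 {y : ℝ} (hy : 0 < y) : HasDerivAt eulerK0 (y * K0 y) y := by
  refine ((hasDerivAt_id y).mul (hasDerivAt_K1 hy)).neg.congr_deriv ?_
  simp only [id]; field_simp; ring

lemma hasDerivAt_eulerK0₂ {y : ℝ} (hy : 0 < y) :
    HasDerivAt eulerK0₂ (2 * y * K0 y - y ^ 2 * K1 y) y := by
  refine ((hasDerivAt_pow 2 y).mul (hasDerivAt_K0 hy)).congr_deriv ?_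
  norm_num; ring

lemma continuousOn_K0 : ContinuousOn K0 (Ioi 0) :=
  fun _ hy => (hasDerivAt_K0 hy).continuousAt.continuousWithinAt

lemma continuousOn_K1 : ContinuousOn K1 (Ioi 0) :=
  fun _ hy => (hasDerivAt_K1 hy).continuousAt.continuousWithinAt

lemma continuousOn_eulerK0 : ContinuousOn eulerK0 (Ioi 0) :=
  fun _ hy => (hasDerivAt_eulerK0 hy).continuousAt.continuousWithinAt

lemma continuousOn_eulerK0₂ : ContinuousOn eulerK0₂ (Ioi 0) :=
  fun _ hy => (hasDerivAt_eulerK0₂ hy).continuousAt.continuousWithinAt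

lemma continuousOn_eulerK0₃ : ContinuousOn eulerK0₃ (Ioi 0) := by
  have h0 := continuousOn_K0
  have h1 := continuousOn_K1
  unfold eulerK0₃
  fun_prop

lemma hasDerivAt_nicholson_K0 (ν s : ℝ) :
    HasDerivAt (nicholson K0 ν) (nicholson eulerK0 ν s) s :=
  hasDerivAt_nicholson decaying_K0 decaying_eulerK0 (fun _ hy => hasDerivAt_K0 hy)
    (fun y _ => by simp [eulerK0]) continuousOn_eulerK0 ν s

lemma hasDerivAt_nicholson_eulerK0 (ν s : ℝ) :
    HasDerivAt (nicholson eulerK0 ν) (nicholson eulerK0₂ ν s) s :=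
  hasDerivAt_nicholson decaying_eulerK0 decaying_eulerK0₂ (fun _ hy => hasDerivAt_eulerK0 hy)
    (fun y _ => by simp only [eulerK0₂]; ring) continuousOn_eulerK0₂ ν s

lemma hasDerivAt_nicholson_eulerK0₂ (ν s : ℝ) :
    HasDerivAt (nicholson eulerK0₂ ν) (nicholson eulerK0₃ ν s) s :=
  hasDerivAt_nicholson decaying_eulerK0₂ decaying_eulerK0₃ (fun _ hy => hasDerivAt_eulerK0₂ hy)
    (fun y _ => by simp only [eulerK0₃]; ring) continuousOn_eulerK0₃ ν s

lemma hasDerivAt_two_mul_sinh (x t : ℝ) :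
    HasDerivAt (fun t => 2 * x * sinh t) (2 * x * cosh t) t :=
  (Real.hasDerivAt_sinh t).const_mul _

lemma hasDerivAt_cosh_mul (a t : ℝ) : HasDerivAt (fun t => cosh (a * t)) (a * sinh (a * t)) t := by
  have h : HasDerivAt (fun t => a * t) (a * 1) t := (hasDerivAt_id t).const_mul a
  exact h.cosh.congr_deriv (by ring)

lemma hasDerivAt_sinh_mul (a t : ℝ) : HasDerivAt (fun t => sinh (a * t)) (a * cosh (a * t)) t := by
  have h : HasDerivAt (fun t => a * t) (a * 1) t := (hasDerivAt_id t).const_mul a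
  exact h.sinh.congr_deriv (by ring)

/-- The third-order equation satisfied by products of Bessel functions. -/
lemma nicholson_appell (ν s : ℝ) :
    nicholson eulerK0₃ ν s + 4 * (exp s ^ 2 - ν ^ 2) * nicholson eulerK0 ν s +
      4 * exp s ^ 2 * nicholson K0 ν s = 0 := by
  set x := exp s with hx
  have hx0 : 0 < x := exp_pos s
  have i0 := decaying_K0.integrable_nicholson continuousOn_K0 ν s
  have i1 := decaying_eulerK0.integrable_nicholson continuousOn_eulerK0 ν s
  have i3 := decaying_eulerK0₃.integrable_nicholson continuousOn_eulerK0₃ ν s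
  have e0 := MeasureTheory.integral_const_mul (μ := volume.restrict (Ioi (0:ℝ))) (4 * x ^ 2)
    fun t => K0 (2 * x * sinh t) * cosh (2 * ν * t)
  have e1 := MeasureTheory.integral_const_mul (μ := volume.restrict (Ioi (0:ℝ)))
    (4 * (x ^ 2 - ν ^ 2)) fun t => eulerK0 (2 * x * sinh t) * cosh (2 * ν * t)
  have j01 := i3.add (i1.const_mul (4 * (x ^ 2 - ν ^ 2)))
  have j := j01.add (i0.const_mul (4 * x ^ 2))
  have e2 := MeasureTheory.integral_add i3 (i1.const_mul (4 * (x ^ 2 - ν ^ 2)))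
  have e3 := MeasureTheory.integral_add j01 (i0.const_mul (4 * x ^ 2))
  simp only [Pi.add_apply] at e2 e3
  unfold nicholson
  rw [← e0, ← e1, ← e2, ← e3]
  refine integral_Ioi_deriv_eq_zero (F := fun t =>
    K0 (2 * x * sinh t) * (4 * x ^ 2 * (sinh t * (cosh t * cosh (2 * ν * t)))) +
      eulerK0 (2 * x * sinh t) * (-(2 * ν) * sinh (2 * ν * t))) (by simp) ?_ j ?_
  · intro t ht
    have hs : 0 < sinh t := Real.sinh_pos_iff.2 ht
    have hy : 0 < 2 * x * sinh t := by positivity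
    have d0 := (hasDerivAt_K0 hy).comp t (hasDerivAt_two_mul_sinh x t)
    have d1 := (hasDerivAt_eulerK0 hy).comp t (hasDerivAt_two_mul_sinh x t)
    have w0 := ((Real.hasDerivAt_sinh t).mul ((Real.hasDerivAt_cosh t).mul
      (hasDerivAt_cosh_mul (2 * ν) t))).const_mul (4 * x ^ 2)
    have w1 := (hasDerivAt_sinh_mul (2 * ν) t).const_mul (-(2 * ν))
    refine ((d0.mul w0).add (d1.mul w1)).congr_deriv ?_
    simp only [Function.comp_apply, Pi.mul_apply, eulerK0, eulerK0₃, ← hx]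
    have hc := Real.cosh_sq t
    ring_nf
    simp only [show cosh t ^ 2 = sinh t ^ 2 + 1 from hc]
    ring
  · have h0 := decaying_K0.tendsto_ends (((expBounded_const (4 * x ^ 2)).mul
      (expBounded_sinh_self.mul (expBounded_cosh_self.mul (expBounded_cosh (2 * ν)))))) hx0
    have h1 := decaying_eulerK0.tendsto_ends
      ((expBounded_const (-(2 * ν))).mul (expBounded_sinh (2 * ν))) hx0
    exact ⟨by simpa using h0.1.add h1.1, by simpa using h0.2.add h1.2⟩

lemma hasDerivAt_inv_cosh (t : ℝ) :
    HasDerivAt (fun t => (cosh t)⁻¹) (-sinh t * ((cosh t)⁻¹) ^ 2) t := by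
  refine ((Real.hasDerivAt_cosh t).inv (Real.cosh_pos t).ne').congr_deriv ?_
  field_simp

lemma nicholson_K0_add_eulerK0_nonneg {ν : ℝ} (hν : 0 ≤ ν) (hν' : ν ≤ 1 / 2) (s : ℝ) :
    0 ≤ nicholson K0 ν s + nicholson eulerK0 ν s := by
  set x := exp s with hx
  have hx0 : 0 < x := exp_pos s
  have i0 := decaying_K0.integrable_nicholson continuousOn_K0 ν s
  have i1 := decaying_eulerK0.integrable_nicholson continuousOn_eulerK0 ν s
  have iL := decaying_K0.integrable continuousOn_K0
    (w := fun t => (cosh t)⁻¹ * ((cosh t)⁻¹ * cosh (2 * ν * t)) +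
      2 * ν * (sinh t * ((cosh t)⁻¹ * sinh (2 * ν * t))))
    ((expBounded_inv_cosh.mul (expBounded_inv_cosh.mul (expBounded_cosh (2 * ν)))).add
      ((expBounded_const (2 * ν)).mul (expBounded_zero_sinh_self.mul
        (expBounded_inv_cosh.mul (expBounded_zero_sinh (2 * ν))))))
    (by have := fun t => (Real.cosh_pos t).ne'; fun_prop (disch := assumption)) hx0
  have hzero := integral_Ioi_deriv_eq_zero
    (F := fun t => K0 (2 * x * sinh t) * (sinh t * ((cosh t)⁻¹ * cosh (2 * ν * t)))) (by simp) ?_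
    (iL.add i1) (decaying_K0.tendsto_ends
      (expBounded_sinh_self.mul (expBounded_inv_cosh.mul (expBounded_cosh (2 * ν)))) hx0)
  · have e := MeasureTheory.integral_add iL i1
    have e' := MeasureTheory.integral_sub i0 iL
    simp only [Pi.add_apply] at e e' hzero
    rw [e] at hzero
    have hge : 0 ≤ nicholson K0 ν s - ∫ t in Ioi (0 : ℝ), K0 (2 * x * sinh t) *
        ((cosh t)⁻¹ * ((cosh t)⁻¹ * cosh (2 * ν * t)) +
          2 * ν * (sinh t * ((cosh t)⁻¹ * sinh (2 * ν * t)))) := by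
      unfold nicholson
      rw [← e']
      refine setIntegral_nonneg measurableSet_Ioi fun t ht => ?_
      have hs : 0 < sinh t := Real.sinh_pos_iff.2 ht
      have hK := K0_pos (show 0 < 2 * x * sinh t by positivity)
      have hc := Real.cosh_pos t
      have ht0 : (0 : ℝ) < t := ht
      have h1 : 0 ≤ sinh (t - 2 * ν * t) := Real.sinh_nonneg_iff.2 (by nlinarith)
      have h2 : 0 ≤ sinh (2 * ν * t) := Real.sinh_nonneg_iff.2 (by positivity)
      rw [Real.sinh_sub] at h1
      have h3 : 2 * ν * (cosh t * sinh (2 * ν * t)) ≤ 1 * (cosh t * sinh (2 * ν * t)) := by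
        gcongr; linarith
      have hid : K0 (2 * x * sinh t) * cosh (2 * ν * t) - K0 (2 * x * sinh t) *
          ((cosh t)⁻¹ * ((cosh t)⁻¹ * cosh (2 * ν * t)) +
            2 * ν * (sinh t * ((cosh t)⁻¹ * sinh (2 * ν * t)))) =
          K0 (2 * x * sinh t) * sinh t * ((cosh t)⁻¹) ^ 2 *
            (sinh t * cosh (2 * ν * t) - 2 * ν * (cosh t * sinh (2 * ν * t))) := by
        have h4 := Real.cosh_sq t
        field_simp
        rw [h4]
        ring
      rw [hid]
      have : 0 ≤ sinh t * cosh (2 * ν * t) - 2 * ν * (cosh t * sinh (2 * ν * t)) := by linarith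
      positivity
    have : nicholson eulerK0 ν s =
      ∫ t in Ioi (0 : ℝ), eulerK0 (2 * x * sinh t) * cosh (2 * ν * t) := rfl
    linarith
  · intro t ht
    have hs : 0 < sinh t := Real.sinh_pos_iff.2 ht
    have hy : 0 < 2 * x * sinh t := by positivity
    have d0 := (hasDerivAt_K0 hy).comp t (hasDerivAt_two_mul_sinh x t)
    have w0 := (Real.hasDerivAt_sinh t).mul ((hasDerivAt_inv_cosh t).mul
      (hasDerivAt_cosh_mul (2 * ν) t))
    refine (d0.mul w0).congr_deriv ?_
    have hc := (Real.cosh_pos t).ne'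
    simp only [Function.comp_apply, Pi.mul_apply, Pi.add_apply, eulerK0, ← hx]
    have h4 := Real.cosh_sq t
    field_simp
    rw [h4]
    ring

lemma nicholson_eulerK0₃_nonpos {ν : ℝ} (hν : 1 / 2 ≤ ν) (s : ℝ) :
    nicholson eulerK0₃ ν s ≤ 0 := by
  set x := exp s with hx
  have hx0 : 0 < x := exp_pos s
  set L : ℝ → ℝ := fun t => (cosh t)⁻¹ * ((cosh t)⁻¹ * ((cosh t)⁻¹ * ((cosh t)⁻¹ *
    (cosh (2 * ν * t) * (1 + -2 * (sinh t * sinh t) +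
      (2 * ν) ^ 2 * (sinh t * (sinh t * (cosh t * cosh t)))) +
      3 * (2 * ν) * (sinh t * (sinh (2 * ν * t) * cosh t)))))) with hL
  have bL : ExpBounded 0 L := by
    have i := expBounded_inv_cosh
    have c := expBounded_cosh_self
    have h := expBounded_zero_sinh_self
    exact i.mul (i.mul (i.mul (i.mul (((expBounded_cosh (2 * ν)).mul
      (((expBounded_const 1).add ((expBounded_const (-2)).mul (h.mul h))).add
        ((expBounded_const ((2 * ν) ^ 2)).mul (h.mul (h.mul (c.mul c)))))).add
      ((expBounded_const (3 * (2 * ν))).mul (h.mul ((expBounded_zero_sinh (2 * ν)).mul c)))))))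
  have cL : Continuous L := by
    have := fun t => (Real.cosh_pos t).ne'
    fun_prop (disch := assumption)
  have hLnn : ∀ t, 0 < t → 0 ≤ L t := by
    intro t ht
    have hs : 0 < sinh t := Real.sinh_pos_iff.2 ht
    have hc := Real.cosh_pos t
    have hC := Real.cosh_pos (2 * ν * t)
    have h1 : 0 ≤ sinh (2 * ν * t - t) := Real.sinh_nonneg_iff.2 (by nlinarith)
    rw [Real.sinh_sub] at h1
    have h4 := Real.cosh_sq t
    have h5 : 1 * (sinh t * (cosh (2 * ν * t) * sinh t)) ≤
        2 * ν * (sinh t * (sinh (2 * ν * t) * cosh t)) := by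
      have h2 : 0 ≤ sinh (2 * ν * t) := Real.sinh_nonneg_iff.2 (by positivity)
      calc 1 * (sinh t * (cosh (2 * ν * t) * sinh t))
          ≤ 1 * (sinh t * (sinh (2 * ν * t) * cosh t)) :=
            mul_le_mul_of_nonneg_left (mul_le_mul_of_nonneg_left (by linarith) hs.le) zero_le_one
        _ ≤ _ := by gcongr; linarith
    have h6 : 1 * (sinh t * (sinh t * (cosh t * cosh t))) ≤
        (2 * ν) ^ 2 * (sinh t * (sinh t * (cosh t * cosh t))) := by
      gcongr; nlinarith
    have h7 : 0 ≤ cosh (2 * ν * t) * (1 + -2 * (sinh t * sinh t) +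
      (2 * ν) ^ 2 * (sinh t * (sinh t * (cosh t * cosh t)))) +
      3 * (2 * ν) * (sinh t * (sinh (2 * ν * t) * cosh t)) := by
      have h8 : cosh (2 * ν * t) * (1 + -2 * (sinh t * sinh t) +
          1 * (sinh t * (sinh t * (cosh t * cosh t)))) ≤
          cosh (2 * ν * t) * (1 + -2 * (sinh t * sinh t) +
            (2 * ν) ^ 2 * (sinh t * (sinh t * (cosh t * cosh t)))) := by gcongr
      have h9 : sinh t * (sinh t * (cosh t * cosh t)) = sinh t ^ 2 * (sinh t ^ 2 + 1) := by
        rw [← h4]; ring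
      rw [h9] at h8
      have h10 : 0 ≤ cosh (2 * ν * t) * (1 + 2 * sinh t ^ 2 + sinh t ^ 4) := by positivity
      nlinarith
    rw [hL]; positivity
  have i3 := decaying_eulerK0₃.integrable_nicholson continuousOn_eulerK0₃ ν s
  have iL := decaying_eulerK0.integrable continuousOn_eulerK0 bL cL hx0
  have hb : ExpBounded 1 fun t => -1 * (sinh t * ((cosh t)⁻¹ * ((cosh t)⁻¹ * ((cosh t)⁻¹ *
      cosh (2 * ν * t))) + 2 * ν * (sinh t * ((cosh t)⁻¹ * ((cosh t)⁻¹ * sinh (2 * ν * t)))))) := by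
    have i := expBounded_inv_cosh
    exact (expBounded_const (-1)).mul (expBounded_sinh_self.mul ((i.mul (i.mul (i.mul
      (expBounded_cosh (2 * ν))))).add ((expBounded_const (2 * ν)).mul
        (expBounded_zero_sinh_self.mul (i.mul (i.mul (expBounded_zero_sinh (2 * ν))))))))
  have l1 := decaying_eulerK0₂.tendsto_ends
    (expBounded_sinh_self.mul (expBounded_inv_cosh.mul (expBounded_cosh (2 * ν)))) hx0
  have l2 := decaying_eulerK0.tendsto_ends hb hx0
  have hzero := integral_Ioi_deriv_eq_zero
    (F := fun t => eulerK0₂ (2 * x * sinh t) * (sinh t * ((cosh t)⁻¹ * cosh (2 * ν * t))) +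
      eulerK0 (2 * x * sinh t) * (-1 * (sinh t * ((cosh t)⁻¹ * ((cosh t)⁻¹ * ((cosh t)⁻¹ *
        cosh (2 * ν * t))) + 2 * ν * (sinh t * ((cosh t)⁻¹ * ((cosh t)⁻¹ * sinh (2 * ν * t))))))))
    (by simp) ?_ (i3.sub iL) ⟨by simpa using l1.1.add l2.1, by simpa using l1.2.add l2.2⟩
  · have e := MeasureTheory.integral_sub i3 iL
    simp only [Pi.sub_apply] at e hzero
    rw [e] at hzero
    have : nicholson eulerK0₃ ν s =
      ∫ t in Ioi (0 : ℝ), eulerK0₃ (2 * x * sinh t) * cosh (2 * ν * t) := rfl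
    have h : ∫ t in Ioi (0 : ℝ), eulerK0 (2 * x * sinh t) * L t ≤ 0 := by
      refine setIntegral_nonpos measurableSet_Ioi fun t ht => ?_
      have hs : 0 < sinh t := Real.sinh_pos_iff.2 ht
      refine mul_nonpos_of_nonpos_of_nonneg ?_ (hLnn t ht)
      rw [eulerK0, neg_nonpos]
      exact mul_nonneg (by positivity) (K1_nonneg _)
    linarith
  · intro t ht
    have hs : 0 < sinh t := Real.sinh_pos_iff.2 ht
    have hy : 0 < 2 * x * sinh t := by positivity
    have d1 := (hasDerivAt_eulerK0 hy).comp t (hasDerivAt_two_mul_sinh x t)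
    have d2 := (hasDerivAt_eulerK0₂ hy).comp t (hasDerivAt_two_mul_sinh x t)
    have i := hasDerivAt_inv_cosh t
    have h := Real.hasDerivAt_sinh t
    have w2 := h.mul (i.mul (hasDerivAt_cosh_mul (2 * ν) t))
    have w1 := (h.mul ((i.mul (i.mul (i.mul (hasDerivAt_cosh_mul (2 * ν) t)))).add
      ((h.mul (i.mul (i.mul (hasDerivAt_sinh_mul (2 * ν) t)))).const_mul (2 * ν)))).const_mul (-1)
    refine ((d2.mul w2).add (d1.mul w1)).congr_deriv ?_
    have hc := (Real.cosh_pos t).ne'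
    simp only [Function.comp_apply, Pi.mul_apply, Pi.add_apply, Pi.sub_apply, eulerK0, eulerK0₂,
      eulerK0₃, hL, ← hx]
    have h4 : cosh t ^ 2 = sinh t ^ 2 + 1 := Real.cosh_sq t
    field_simp
    have h44 : cosh t ^ 4 = (sinh t ^ 2 + 1) ^ 2 := by rw [← h4]; ring
    have h43 : cosh t ^ 3 = (sinh t ^ 2 + 1) * cosh t := by rw [← h4]; ring
    ring_nf
    simp only [h4, h43, h44]
    ring

lemma hasDerivAt_arctan_sinh (t : ℝ) : HasDerivAt (fun t => arctan (sinh t)) (cosh t)⁻¹ t := by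
  refine (Real.hasDerivAt_sinh t).arctan.congr_deriv ?_
  have h := Real.cosh_sq t
  have hc := (Real.cosh_pos t).ne'
  rw [show 1 + sinh t ^ 2 = cosh t ^ 2 by rw [h]; ring]
  field_simp

lemma tendsto_arctan_sinh : Tendsto (fun t => arctan (sinh t)) atTop (𝓝 (π / 2)) := by
  have h : Tendsto sinh atTop atTop :=
    tendsto_atTop_mono' _ ((eventually_ge_atTop 0).mono fun t ht => Real.self_le_sinh_iff.2 ht)
      tendsto_id
  exact (tendsto_nhds_of_tendsto_nhdsWithin Real.tendsto_arctan_atTop).comp h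

lemma integrableOn_inv_cosh : IntegrableOn (fun t => (cosh t)⁻¹) (Ioi 0) :=
  integrableOn_Ioi_deriv_of_nonneg' (fun t _ => hasDerivAt_arctan_sinh t)
    (fun t _ => (inv_pos.2 (Real.cosh_pos t)).le) tendsto_arctan_sinh

lemma integral_inv_cosh : ∫ t in Ioi (0 : ℝ), (cosh t)⁻¹ = π / 2 := by
  have := integral_Ioi_of_hasDerivAt_of_tendsto' (a := 0) (fun t _ => hasDerivAt_arctan_sinh t)
    integrableOn_inv_cosh tendsto_arctan_sinh
  simpa using this

lemma integral_K0 : ∫ y in Ioi (0 : ℝ), K0 y = π / 2 := by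
  have he : ∀ t : ℝ, ∫ y in Ioi (0 : ℝ), exp (-y * cosh t) = (cosh t)⁻¹ := fun t => by
    have := integral_exp_mul_Ioi (a := -cosh t) (by simpa using Real.cosh_pos t) 0
    simp only [mul_zero, Real.exp_zero, neg_div_neg_eq] at this
    rw [← one_div, ← this]
    congr 1; ext y; ring_nf
  have hi : ∀ t : ℝ, IntegrableOn (fun y => exp (-y * cosh t)) (Ioi (0 : ℝ)) := fun t => by
    by_contra hcon
    have := he t
    rw [integral_undef hcon] at this
    exact (inv_pos.2 (Real.cosh_pos t)).ne this
  unfold K0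
  rw [integral_integral_swap, ← integral_inv_cosh]
  · simp only [he]
  · refine (integrable_prod_iff' (Continuous.aestronglyMeasurable (by fun_prop))).2
      ⟨Eventually.of_forall hi, ?_⟩
    simp only [Function.uncurry_apply_pair, Real.norm_eq_abs, Real.abs_exp, he]
    exact integrableOn_inv_cosh

lemma tendsto_mul_sinh_div (τ : ℝ) (hτ : 0 < τ) :
    Tendsto (fun x : ℝ => 2 * x * sinh (τ / x)) atTop (𝓝 (2 * τ)) := by
  have h1 := (Real.hasDerivAt_sinh 0).tendsto_slope_zero
  have h2 : Tendsto (fun x : ℝ => τ / x) atTop (𝓝[≠] 0) :=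
    tendsto_nhdsWithin_iff.2 ⟨tendsto_const_nhds.div_atTop tendsto_id,
      (eventually_gt_atTop 0).mono fun x hx => (div_pos hτ hx).ne'⟩
  have h3 := (h1.comp h2).const_mul (2 * τ)
  simp only [Real.cosh_zero, mul_one] at h3
  refine h3.congr' ((eventually_gt_atTop 0).mono fun x hx => ?_)
  simp
  field_simp

lemma tendsto_mul_integral_K0 (ν : ℝ) :
    Tendsto (fun x : ℝ => x * ∫ t in Ioi (0 : ℝ), K0 (2 * x * sinh t) * cosh (2 * ν * t)) atTop
      (𝓝 (π / 4)) := by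
  have hval : ∫ τ in Ioi (0 : ℝ), K0 (2 * τ) = π / 4 := by
    rw [integral_comp_mul_left_Ioi _ _ two_pos, mul_zero, integral_K0, smul_eq_mul]; ring
  rw [← hval]
  have hrw : ∀ x : ℝ, 0 < x → ∫ τ in Ioi (0 : ℝ), K0 (2 * x * sinh (τ / x)) *
      cosh (2 * ν * (τ / x)) = x * ∫ t in Ioi (0 : ℝ), K0 (2 * x * sinh t) * cosh (2 * ν * t) := by
    intro x hx
    have h := integral_comp_mul_left_Ioi (fun τ => K0 (2 * x * sinh (τ / x)) *
      cosh (2 * ν * (τ / x))) 0 hx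
    simp only [mul_zero, mul_div_cancel_left₀ _ hx.ne', smul_eq_mul] at h
    rw [h, ← mul_assoc, mul_inv_cancel₀ hx.ne', one_mul]
  refine Tendsto.congr' ((eventually_gt_atTop 0).mono hrw) ?_
  refine tendsto_integral_filter_of_dominated_convergence (fun τ => 2 * ((√τ)⁻¹ * exp (-τ))) ?_ ?_
    (integrableOn_inv_sqrt_mul_exp_neg.const_mul 2) ?_
  · filter_upwards [eventually_gt_atTop 0] with x hx
    refine ContinuousOn.aestronglyMeasurable ?_ measurableSet_Ioi
    refine ContinuousOn.mul (continuousOn_K0.comp (by fun_prop) fun t ht => ?_) (by fun_prop)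
    have : 0 < sinh (t / x) := Real.sinh_pos_iff.2 (div_pos ht hx)
    simp only [mem_Ioi]; positivity
  · filter_upwards [eventually_gt_atTop 0, eventually_ge_atTop |2 * ν|] with x hx hx'
    filter_upwards [ae_restrict_mem measurableSet_Ioi] with τ hτ
    have hτ : 0 < τ := hτ
    have hu : 0 < τ / x := div_pos hτ hx
    have hs : τ / x ≤ sinh (τ / x) := Real.self_le_sinh_iff.2 hu.le
    have hs0 : 0 < sinh (τ / x) := Real.sinh_pos_iff.2 hu
    have hy : 2 * τ ≤ 2 * x * sinh (τ / x) := by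
      calc 2 * τ = 2 * x * (τ / x) := by field_simp
        _ ≤ _ := by gcongr
    have hy0 : 0 < 2 * x * sinh (τ / x) := by positivity
    have hc : cosh (2 * ν * (τ / x)) ≤ exp τ := by
      refine cosh_mul_le_exp.trans (Real.exp_le_exp.2 ?_)
      rw [abs_of_pos hu]
      calc |2 * ν| * (τ / x) ≤ x * (τ / x) := by gcongr
        _ = τ := by field_simp
    have hK := K0_pos hy0
    rw [Real.norm_of_nonneg (mul_nonneg hK.le (Real.cosh_pos _).le)]
    calc K0 (2 * x * sinh (τ / x)) * cosh (2 * ν * (τ / x))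
        ≤ 2 * ((√(2 * x * sinh (τ / x)))⁻¹ * exp (-(2 * x * sinh (τ / x)))) * exp τ := by
          have := Real.cosh_pos (2 * ν * (τ / x))
          gcongr
          exact K0_le hy0
      _ ≤ 2 * ((√τ)⁻¹ * exp (-(2 * τ))) * exp τ := by
          have : 0 < √τ := Real.sqrt_pos.2 hτ
          gcongr
          linarith
      _ = 2 * ((√τ)⁻¹ * (exp (-(2 * τ)) * exp τ)) := by ring
      _ = _ := by rw [← Real.exp_add]; ring_nf
  · filter_upwards [ae_restrict_mem measurableSet_Ioi] with τ hτ
    have hτ : 0 < τ := hτ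
    have h1 := (hasDerivAt_K0 (mul_pos two_pos hτ)).continuousAt.tendsto.comp
      (tendsto_mul_sinh_div τ hτ)
    have h2 : Tendsto (fun x : ℝ => cosh (2 * ν * (τ / x))) atTop (𝓝 (cosh (2 * ν * 0))) :=
      (Real.continuous_cosh.tendsto _).comp
        ((tendsto_const_nhds.div_atTop tendsto_id).const_mul _)
    simpa using h1.mul h2

/-- The squared modulus in the logarithmic variable. -/
noncomputable def mod0 (ν s : ℝ) : ℝ := 8 / π ^ 2 * nicholson K0 ν s

/-- The first derivative of `mod0`. -/
noncomputable def mod1 (ν s : ℝ) : ℝ := 8 / π ^ 2 * nicholson eulerK0 ν s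

/-- The second derivative of `mod0`. -/
noncomputable def mod2 (ν s : ℝ) : ℝ := 8 / π ^ 2 * nicholson eulerK0₂ ν s

/-- The third derivative of `mod0`. -/
noncomputable def mod3 (ν s : ℝ) : ℝ := 8 / π ^ 2 * nicholson eulerK0₃ ν s

lemma M2_exp (ν s : ℝ) : M2 ν (exp s) = mod0 ν s := rfl

lemma hasDerivAt_mod0 (ν s : ℝ) : HasDerivAt (mod0 ν) (mod1 ν s) s :=
  (hasDerivAt_nicholson_K0 ν s).const_mul _

lemma hasDerivAt_mod1 (ν s : ℝ) : HasDerivAt (mod1 ν) (mod2 ν s) s :=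
  (hasDerivAt_nicholson_eulerK0 ν s).const_mul _

lemma hasDerivAt_mod2 (ν s : ℝ) : HasDerivAt (mod2 ν) (mod3 ν s) s :=
  (hasDerivAt_nicholson_eulerK0₂ ν s).const_mul _

lemma mod_appell (ν s : ℝ) :
    mod3 ν s + 4 * (exp s ^ 2 - ν ^ 2) * mod1 ν s + 4 * exp s ^ 2 * mod0 ν s = 0 := by
  have := nicholson_appell ν s
  unfold mod0 mod1 mod3
  linear_combination (8 / π ^ 2) * this

lemma tendsto_mod1_atTop (ν : ℝ) : Tendsto (mod1 ν) atTop (𝓝 0) := by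
  have h := (tendsto_nicholson_atTop decaying_eulerK0 continuousOn_eulerK0 ν).const_mul (8 / π ^ 2)
  rwa [mul_zero] at h

lemma tendsto_mod0_atTop (ν : ℝ) : Tendsto (mod0 ν) atTop (𝓝 0) := by
  have h := (tendsto_nicholson_atTop decaying_K0 continuousOn_K0 ν).const_mul (8 / π ^ 2)
  rwa [mul_zero] at h

lemma tendsto_mod2_atTop (ν : ℝ) : Tendsto (mod2 ν) atTop (𝓝 0) := by
  have h := (tendsto_nicholson_atTop decaying_eulerK0₂ continuousOn_eulerK0₂ ν).const_mul (8 / π ^ 2)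
  rwa [mul_zero] at h

lemma tendsto_exp_mul_mod0 (ν : ℝ) :
    Tendsto (fun s => exp s * mod0 ν s) atTop (𝓝 (2 / π)) := by
  have h := ((tendsto_mul_integral_K0 ν).comp Real.tendsto_exp_atTop).const_mul (8 / π ^ 2)
  rw [show 8 / π ^ 2 * (π / 4) = 2 / π by have := Real.pi_ne_zero; field_simp; norm_num] at h
  refine h.congr fun s => ?_
  simp only [Function.comp_apply, mod0, nicholson]
  ring

lemma nicholson_K0_mono {μ ν : ℝ} (hμ : 0 ≤ μ) (h : μ ≤ ν) (s : ℝ) :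
    nicholson K0 μ s ≤ nicholson K0 ν s := by
  refine setIntegral_mono_on (decaying_K0.integrable_nicholson continuousOn_K0 μ s)
    (decaying_K0.integrable_nicholson continuousOn_K0 ν s) measurableSet_Ioi fun t ht => ?_
  have ht : 0 < t := ht
  have hs : 0 < sinh t := Real.sinh_pos_iff.2 ht
  have hK := K0_pos (show 0 < 2 * exp s * sinh t by positivity)
  gcongr
  rw [Real.cosh_le_cosh, abs_of_nonneg (by positivity), abs_of_nonneg (by
    have := hμ.trans h
    positivity)]
  gcongr

lemma nicholson_K0_pos (ν s : ℝ) : 0 < nicholson K0 ν s := by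
  have hnn : ∀ t ∈ Ioi (0 : ℝ), 0 < K0 (2 * exp s * sinh t) * cosh (2 * ν * t) := fun t ht => by
    have hs : 0 < sinh t := Real.sinh_pos_iff.2 ht
    exact mul_pos (K0_pos (by positivity)) (Real.cosh_pos _)
  refine (setIntegral_pos_iff_support_of_nonneg_ae ?_
    (decaying_K0.integrable_nicholson continuousOn_K0 ν s)).2 ?_
  · filter_upwards [ae_restrict_mem measurableSet_Ioi] with t ht using (hnn t ht).le
  · rw [inter_eq_right.2 (show Ioi (0 : ℝ) ⊆ Function.support _ from fun t ht => (hnn t ht).ne')]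
    simp

lemma mod0_pos (ν s : ℝ) : 0 < mod0 ν s :=
  mul_pos (by positivity) (nicholson_K0_pos ν s)

lemma mod0_mono {μ ν : ℝ} (hμ : 0 ≤ μ) (h : μ ≤ ν) (s : ℝ) : mod0 μ s ≤ mod0 ν s :=
  mul_le_mul_of_nonneg_left (nicholson_K0_mono hμ h s) (by positivity)

lemma hasDerivAt_exp_sq_sub (ν s : ℝ) :
    HasDerivAt (fun s => exp s ^ 2 - ν ^ 2) (2 * exp s ^ 2) s :=
  (((Real.hasDerivAt_exp s).pow 2).sub_const (ν ^ 2)).congr_deriv (by norm_num; ring)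

lemma tendsto_exp_sq_sub_mul_mod0_sq (ν : ℝ) :
    Tendsto (fun s => (exp s ^ 2 - ν ^ 2) * mod0 ν s ^ 2) atTop (𝓝 ((2 / π) ^ 2)) := by
  have h := ((tendsto_exp_mul_mod0 ν).pow 2).sub (((tendsto_mod0_atTop ν).pow 2).const_mul (ν ^ 2))
  simp only [ne_eq, OfNat.ofNat_ne_zero, not_false_eq_true, zero_pow, mul_zero, sub_zero] at h
  exact h.congr fun s => by ring

lemma eq_of_deriv_zero_of_tendsto {f : ℝ → ℝ} {l : ℝ} (hd : ∀ s, HasDerivAt f 0 s)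
    (hl : Tendsto f atTop (𝓝 l)) (s : ℝ) : f s = l := by
  have hc : ∀ t, f t = f s := fun t =>
    is_const_of_deriv_eq_zero (fun t => (hd t).differentiableAt) (fun t => (hd t).deriv) t s
  exact tendsto_nhds_unique (tendsto_const_nhds.congr fun t => (hc t).symm) hl

/-- The first integral of the third-order equation. -/
lemma mod_energy (ν s : ℝ) :
    2 * mod0 ν s * mod2 ν s - mod1 ν s ^ 2 + 4 * (exp s ^ 2 - ν ^ 2) * mod0 ν s ^ 2 =
      4 * (2 / π) ^ 2 := by
  refine eq_of_deriv_zero_of_tendsto (f := fun s => 2 * mod0 ν s * mod2 ν s - mod1 ν s ^ 2 +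
    4 * (exp s ^ 2 - ν ^ 2) * mod0 ν s ^ 2) (fun s => ?_) ?_ s
  · have h := ((((hasDerivAt_mod0 ν s).const_mul 2).mul (hasDerivAt_mod2 ν s)).sub
      ((hasDerivAt_mod1 ν s).pow 2)).add
      (((hasDerivAt_exp_sq_sub ν s).const_mul 4).mul ((hasDerivAt_mod0 ν s).pow 2))
    refine h.congr_deriv ?_
    have ha := mod_appell ν s
    norm_num
    linear_combination (2 * mod0 ν s) * ha
  · have h := ((((tendsto_mod0_atTop ν).const_mul 2).mul (tendsto_mod2_atTop ν)).sub
      ((tendsto_mod1_atTop ν).pow 2)).add ((tendsto_exp_sq_sub_mul_mod0_sq ν).const_mul 4)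
    norm_num at h
    refine h.congr fun s => by ring

lemma le_of_deriv_nonneg_of_tendsto {f f' : ℝ → ℝ} {l : ℝ} (hd : ∀ s, HasDerivAt f (f' s) s)
    (h0 : ∀ s, 0 ≤ f' s) (hl : Tendsto f atTop (𝓝 l)) (s : ℝ) : f s ≤ l :=
  (monotone_of_hasDerivAt_nonneg hd h0).ge_of_tendsto hl s

lemma exp_sq_sub_mul_mod0_sq_le {ν : ℝ} (hν : 0 ≤ ν) (s : ℝ) :
    (exp s ^ 2 - ν ^ 2) * mod0 ν s ^ 2 ≤ (2 / π) ^ 2 := by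
  rcases le_total ν (1 / 2) with h | h
  · have h1 : (exp s * mod0 ν s) ^ 2 ≤ (2 / π) ^ 2 := by
      have hm : exp s * mod0 ν s ≤ 2 / π := by
        refine le_of_deriv_nonneg_of_tendsto (f := fun s => exp s * mod0 ν s)
          (fun s => (Real.hasDerivAt_exp s).mul (hasDerivAt_mod0 ν s)) (fun s => ?_)
          (tendsto_exp_mul_mod0 ν) s
        have := nicholson_K0_add_eulerK0_nonneg hν h s
        rw [← mul_add, mod0, mod1, ← mul_add]
        positivity
      have := mod0_pos ν s
      gcongr
    nlinarith [sq_nonneg (ν * mod0 ν s)]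
  · refine le_of_deriv_nonneg_of_tendsto (f := fun s => (exp s ^ 2 - ν ^ 2) * mod0 ν s ^ 2)
      (fun s => (hasDerivAt_exp_sq_sub ν s).mul ((hasDerivAt_mod0 ν s).pow 2)) (fun s => ?_)
      (tendsto_exp_sq_sub_mul_mod0_sq ν) s
    have h3 : mod3 ν s ≤ 0 :=
      mul_nonpos_of_nonneg_of_nonpos (by positivity) (nicholson_eulerK0₃_nonpos h s)
    have ha := mod_appell ν s
    have h0 := mod0_pos ν s
    have : 0 ≤ -mod3 ν s * mod0 ν s := mul_nonneg (by linarith) h0.le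
    norm_num
    nlinarith

/-- Integrand of the Laplace-type representation of the Hankel function. -/
noncomputable def hankelKernel (lam : ℝ) (j : ℕ) (x r : ℝ) : ℂ :=
  (((-r) ^ j * exp (-(x * r)) * r ^ lam : ℝ) : ℂ) * (1 + ((r / 2 : ℝ) : ℂ) * Complex.I) ^ (lam : ℂ)

/-- Derivatives of the (normalised) Hankel function. -/
noncomputable def hankelMoment (lam : ℝ) (j : ℕ) (x : ℝ) : ℂ :=
  ∫ r in Ioi (0 : ℝ), hankelKernel lam j x r

lemma one_add_mul_I_mem_slitPlane (y : ℝ) : 1 + (y : ℂ) * Complex.I ∈ Complex.slitPlane := by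
  simp [Complex.slitPlane]

lemma norm_cpow_le_of_norm_le {z : ℂ} {u lam : ℝ} (hz : ‖z‖ ≤ u) (h1 : 1 ≤ u)
    (h : 1 ≤ ‖z‖ ∨ 0 ≤ lam) : ‖z ^ (lam : ℂ)‖ ≤ u ^ ⌈|lam|⌉₊ := by
  rw [Complex.norm_cpow_real]
  have hle : lam ≤ ⌈|lam|⌉₊ := (le_abs_self lam).trans (Nat.le_ceil _)
  rw [← Real.rpow_natCast]
  rcases h with h | h
  · calc ‖z‖ ^ lam ≤ ‖z‖ ^ (⌈|lam|⌉₊ : ℝ) := Real.rpow_le_rpow_of_exponent_le h hle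
      _ ≤ _ := by gcongr
  · calc ‖z‖ ^ lam ≤ u ^ lam := by gcongr
      _ ≤ _ := Real.rpow_le_rpow_of_exponent_le h1 hle

lemma norm_one_add_mul_I_cpow_le (lam : ℝ) {y : ℝ} (hy : 0 ≤ y) :
    ‖(1 + (y : ℂ) * Complex.I) ^ (lam : ℂ)‖ ≤ (1 + y) ^ ⌈|lam|⌉₊ := by
  refine norm_cpow_le_of_norm_le ?_ (by linarith) (Or.inl ?_)
  · refine (norm_add_le _ _).trans (le_of_eq ?_)
    simp [abs_of_nonneg hy]
  · refine le_trans ?_ (Complex.re_le_norm _)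
    simp

lemma one_add_pow_le_exp (k : ℕ) {b : ℝ} (hb : 0 < b) :
    ∃ C, 0 ≤ C ∧ ∀ r, 0 < r → (1 + r) ^ k ≤ C * exp (b * r) := by
  refine ⟨k.factorial / b ^ k * exp b, by positivity, fun r hr => ?_⟩
  have h := Real.pow_div_factorial_le_exp (b * (1 + r)) (by positivity) k
  rw [div_le_iff₀ (by positivity), mul_pow] at h
  rw [mul_assoc, ← Real.exp_add, div_mul_eq_mul_div, le_div_iff₀ (by positivity)]
  rw [show b + b * r = b * (1 + r) by ring]
  linarith

lemma norm_hankelKernel_le (lam : ℝ) (j : ℕ) {x₀ : ℝ} (hx₀ : 0 < x₀) :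
    ∃ C, 0 ≤ C ∧ ∀ x, x₀ ≤ x → ∀ r, 0 < r →
      ‖hankelKernel lam j x r‖ ≤ C * (r ^ lam * exp (-(x₀ / 2) * r)) := by
  obtain ⟨C, hC, h⟩ := one_add_pow_le_exp (j + ⌈|lam|⌉₊) (half_pos hx₀)
  refine ⟨C, hC, fun x hx r hr => ?_⟩
  rw [hankelKernel, norm_mul, Complex.norm_real, Real.norm_eq_abs, abs_mul, abs_mul, abs_pow,
    abs_neg, abs_of_pos hr, Real.abs_exp, abs_of_nonneg (Real.rpow_nonneg hr.le _)]
  have h1 := norm_one_add_mul_I_cpow_le lam (y := r / 2) (by positivity)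
  have h2 : (1 + r / 2) ^ ⌈|lam|⌉₊ ≤ (1 + r) ^ ⌈|lam|⌉₊ := by gcongr; linarith
  have hrp := Real.rpow_nonneg hr.le lam
  calc r ^ j * exp (-(x * r)) * r ^ lam * ‖(1 + ((r / 2 : ℝ) : ℂ) * Complex.I) ^ (lam : ℂ)‖
      ≤ (1 + r) ^ j * exp (-(x₀ * r)) * r ^ lam * (1 + r) ^ ⌈|lam|⌉₊ := by
        gcongr
        · linarith
        · exact h1.trans h2
    _ = (1 + r) ^ (j + ⌈|lam|⌉₊) * (r ^ lam * exp (-(x₀ * r))) := by rw [pow_add]; ring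
    _ ≤ C * exp (x₀ / 2 * r) * (r ^ lam * exp (-(x₀ * r))) := by
        gcongr; exact h r hr
    _ = C * (r ^ lam * (exp (x₀ / 2 * r) * exp (-(x₀ * r)))) := by ring
    _ = _ := by rw [← Real.exp_add]; ring_nf

lemma integrableOn_rpow_mul_exp {lam b : ℝ} (hl : -1 < lam) (hb : 0 < b) :
    IntegrableOn (fun r : ℝ => r ^ lam * exp (-b * r)) (Ioi 0) := by
  simpa using integrableOn_rpow_mul_exp_neg_mul_rpow hl one_pos hb

lemma continuous_cpow_weight (lam : ℝ) :
    Continuous fun r : ℝ => (1 + ((r / 2 : ℝ) : ℂ) * Complex.I) ^ (lam : ℂ) :=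
  Continuous.cpow (by fun_prop) (by fun_prop) fun r => one_add_mul_I_mem_slitPlane _

lemma continuousOn_hankelKernel (lam : ℝ) (j : ℕ) (x : ℝ) :
    ContinuousOn (hankelKernel lam j x) (Ioi 0) := by
  have h : ContinuousOn (fun r : ℝ => r ^ lam) (Ioi 0) := fun r hr =>
    (Real.continuousAt_rpow_const r lam (Or.inl (ne_of_gt hr))).continuousWithinAt
  refine ContinuousOn.mul (Complex.continuous_ofReal.comp_continuousOn ?_)
    (continuous_cpow_weight lam).continuousOn
  exact ContinuousOn.mul (by fun_prop) h

lemma integrableOn_hankelKernel {lam x : ℝ} (hl : -1 < lam) (j : ℕ) (hx : 0 < x) :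
    IntegrableOn (hankelKernel lam j x) (Ioi 0) := by
  obtain ⟨C, _, h⟩ := norm_hankelKernel_le lam j hx
  refine Integrable.mono' ((integrableOn_rpow_mul_exp hl (half_pos hx)).const_mul C)
    ((continuousOn_hankelKernel lam j x).aestronglyMeasurable measurableSet_Ioi) ?_
  filter_upwards [ae_restrict_mem measurableSet_Ioi] with r hr using h x le_rfl r hr

lemma hasDerivAt_hankelMoment {lam x : ℝ} (hl : -1 < lam) (j : ℕ) (hx : 0 < x) :
    HasDerivAt (hankelMoment lam j) (hankelMoment lam (j + 1) x) x := by
  obtain ⟨C, _, h⟩ := norm_hankelKernel_le lam (j + 1) (half_pos hx)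
  refine (hasDerivAt_integral_of_dominated_loc_of_deriv_le (μ := volume.restrict (Ioi (0:ℝ)))
    (F := hankelKernel lam j) (F' := hankelKernel lam (j + 1)) (x₀ := x)
    (bound := fun r => C * (r ^ lam * exp (-(x / 2 / 2) * r)))
    (s := Ioi (x / 2)) (Ioi_mem_nhds (by linarith))
    (Eventually.of_forall fun y =>
      (continuousOn_hankelKernel lam j y).aestronglyMeasurable measurableSet_Ioi)
    (integrableOn_hankelKernel hl j hx)
    ((continuousOn_hankelKernel lam (j + 1) x).aestronglyMeasurable measurableSet_Ioi) ?_
    ((integrableOn_rpow_mul_exp hl (by positivity)).const_mul C) ?_).2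
  · filter_upwards [ae_restrict_mem measurableSet_Ioi] with r hr y hy using h y (le_of_lt hy) r hr
  · refine Eventually.of_forall fun r y _ => ?_
    have h1 : HasDerivAt (fun y : ℝ => -(y * r)) (-(1 * r)) y :=
      ((hasDerivAt_id y).mul_const r).neg
    have h2 := (((h1.exp.const_mul ((-r) ^ j)).mul_const (r ^ lam)).ofReal_comp).mul_const
      ((1 + ((r / 2 : ℝ) : ℂ) * Complex.I) ^ (lam : ℂ))
    refine h2.congr_deriv ?_
    rw [hankelKernel]
    congr 2
    ring

/-- Bessel's equation for the normalised Hankel function. -/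
lemma hankelMoment_bessel {lam x : ℝ} (hl : -1 < lam) (hx : 0 < x) :
    x * (hankelMoment lam 2 x + 2 * Complex.I * hankelMoment lam 1 x) +
      (2 * lam + 2) * (hankelMoment lam 1 x + Complex.I * hankelMoment lam 0 x) = 0 := by
  have i0 := integrableOn_hankelKernel hl 0 hx
  have i1 := integrableOn_hankelKernel hl 1 hx
  have i2 := integrableOn_hankelKernel hl 2 hx
  have hl1 : 0 < lam + 1 := by linarith
  obtain ⟨C, hC, hb⟩ := norm_hankelKernel_le (lam + 1) 0 hx
  have ha := (i1.const_mul (x : ℂ)).sub (i2.const_mul (x * (Complex.I / 2)))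
  have hb2 := (i0.sub (i1.const_mul Complex.I)).const_mul ((lam : ℂ) + 1)
  have key := integral_Ioi_of_hasDerivAt_of_tendsto (a := 0) (m := 0)
    (f := hankelKernel (lam + 1) 0 x) ?_ ?_ (ha.add hb2) ?_
  · have e1 := MeasureTheory.integral_add ha hb2
    have e2 := MeasureTheory.integral_sub (i1.const_mul (x : ℂ))
      (i2.const_mul (x * (Complex.I / 2)))
    have e3 := MeasureTheory.integral_sub i0 (i1.const_mul Complex.I)
    have e4 := MeasureTheory.integral_const_mul (μ := volume.restrict (Ioi (0:ℝ)))
      ((lam : ℂ) + 1) (fun r => hankelKernel lam 0 x r - Complex.I * hankelKernel lam 1 x r)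
    simp only [Pi.add_apply, Pi.sub_apply] at e1 e2 e3 e4 key
    rw [e1, e2, e4, e3, MeasureTheory.integral_const_mul, MeasureTheory.integral_const_mul,
      MeasureTheory.integral_const_mul] at key
    have hz : hankelKernel (lam + 1) 0 x 0 = 0 := by
      simp [hankelKernel, Real.zero_rpow hl1.ne']
    rw [hz] at key
    unfold hankelMoment
    linear_combination (2 * Complex.I) * key + (x * (∫ r in Ioi (0 : ℝ), hankelKernel lam 2 x r) +
      (2 * lam + 2) * (∫ r in Ioi (0 : ℝ), hankelKernel lam 1 x r)) * Complex.I_sq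
  · refine ContinuousAt.continuousWithinAt ?_
    refine ContinuousAt.mul (Complex.continuous_ofReal.continuousAt.comp ?_)
      (continuous_cpow_weight _).continuousAt
    exact ContinuousAt.mul (by fun_prop) (Real.continuousAt_rpow_const 0 _ (Or.inr hl1.le))
  · intro r hr
    have hr : 0 < r := hr
    have h1 : HasDerivAt (fun r : ℝ => -(x * r)) (-(x * 1)) r :=
      ((hasDerivAt_id r).const_mul x).neg
    have h2 := (h1.exp.mul (Real.hasDerivAt_rpow_const (p := lam + 1) (Or.inl hr.ne'))).ofReal_comp
    have h3 : HasDerivAt (fun z : ℂ => 1 + z / 2 * Complex.I) (1 / 2 * Complex.I) (r : ℂ) :=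
      (((hasDerivAt_id (r : ℂ)).div_const 2).mul_const Complex.I).const_add 1
    have hs : 1 + (r : ℂ) / 2 * Complex.I ∈ Complex.slitPlane := by
      simpa using one_add_mul_I_mem_slitPlane (r / 2)
    have h4 := (h3.cpow_const (c := ((lam + 1 : ℝ) : ℂ)) hs).comp_ofReal
    have h5 := h2.mul h4
    have hne := Complex.slitPlane_ne_zero hs
    have hc : (1 + (r : ℂ) / 2 * Complex.I) ^ ((lam : ℂ) + 1) =
        (1 + (r : ℂ) / 2 * Complex.I) ^ (lam : ℂ) * (1 + (r : ℂ) / 2 * Complex.I) := by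
      rw [Complex.cpow_add _ _ hne, Complex.cpow_one]
    have hrl : r ^ (lam + 1) = r ^ lam * r := by rw [Real.rpow_add hr, Real.rpow_one]
    refine (h5.congr_deriv ?_).congr_of_eventuallyEq (Eventually.of_forall fun y => ?_)
    · simp only [Pi.add_apply, Pi.sub_apply, Pi.mul_apply, hankelKernel, add_sub_cancel_right, hrl]
      push_cast
      rw [hc]
      ring_nf
    · simp only [hankelKernel, Pi.mul_apply]
      push_cast
      ring_nf
  · rw [tendsto_zero_iff_norm_tendsto_zero]
    have ht := (tendsto_rpow_mul_exp_neg_mul_atTop_nhds_zero (lam + 1) (x / 2)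
      (half_pos hx)).const_mul C
    rw [mul_zero] at ht
    exact squeeze_zero' (Eventually.of_forall fun _ => norm_nonneg _)
      ((eventually_gt_atTop 0).mono fun r hr => hb x le_rfl r hr) ht

lemma ofReal_rpow_mul_cpow {x : ℝ} (hx : 0 < x) {z : ℂ} (hz : z ≠ 0) (lam : ℝ) :
    ((x ^ lam : ℝ) : ℂ) * z ^ (lam : ℂ) = (x * z) ^ (lam : ℂ) := by
  have hx' : (x : ℂ) ≠ 0 := Complex.ofReal_ne_zero.2 hx.ne'
  rw [Complex.ofReal_cpow hx.le, Complex.cpow_def_of_ne_zero hx', Complex.cpow_def_of_ne_zero hz,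
    Complex.cpow_def_of_ne_zero (mul_ne_zero hx' hz), ← Complex.exp_add,
    Complex.log_ofReal_mul hx hz, Complex.ofReal_log hx.le]
  ring_nf

/-- Rescaled form of the Laplace integral. -/
lemma rpow_mul_hankelMoment (lam : ℝ) (j : ℕ) {x : ℝ} (hx : 0 < x) :
    ((x ^ (lam + 1) * x ^ j : ℝ) : ℂ) * hankelMoment lam j x =
      ∫ t in Ioi (0 : ℝ), (((-t) ^ j * exp (-t) * t ^ lam : ℝ) : ℂ) *
        (1 + ((t / x / 2 : ℝ) : ℂ) * Complex.I) ^ (lam : ℂ) := by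
  have h := integral_comp_mul_left_Ioi (fun t => (((-t) ^ j * exp (-t) * t ^ lam : ℝ) : ℂ) *
        (1 + ((t / x / 2 : ℝ) : ℂ) * Complex.I) ^ (lam : ℂ)) 0 hx
  rw [mul_zero] at h
  have h2 : ∫ r in Ioi (0 : ℝ), (((-(x * r)) ^ j * exp (-(x * r)) * (x * r) ^ lam : ℝ) : ℂ) *
        (1 + ((x * r / x / 2 : ℝ) : ℂ) * Complex.I) ^ (lam : ℂ) =
      ∫ r in Ioi (0 : ℝ), ((x ^ lam * x ^ j : ℝ) : ℂ) * hankelKernel lam j x r := by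
    refine setIntegral_congr_fun measurableSet_Ioi fun r hr => ?_
    have hr : 0 < r := hr
    simp only [hankelKernel, mul_div_cancel_left₀ _ hx.ne', Real.mul_rpow hx.le hr.le,
      ← mul_assoc, ← Complex.ofReal_mul]
    congr 2
    rw [← mul_neg, mul_pow]
    ring
  rw [h2, MeasureTheory.integral_const_mul, Complex.real_smul] at h
  have hx' : (x : ℂ) ≠ 0 := Complex.ofReal_ne_zero.2 hx.ne'
  rw [Real.rpow_add hx, Real.rpow_one, hankelMoment]
  calc _ = (x : ℂ) * (((x ^ lam * x ^ j : ℝ) : ℂ) * ∫ r in Ioi (0 : ℝ), hankelKernel lam j x r) := by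
        push_cast; ring
    _ = _ := by rw [h]; push_cast; rw [← mul_assoc, mul_inv_cancel₀ hx', one_mul]

lemma exists_rescaled_bound (lam : ℝ) (j m : ℕ) : ∃ C, 0 ≤ C ∧ ∀ t, 0 < t → ∀ w : ℂ,
    ‖w‖ ≤ (1 + t) ^ m → ‖(((-t) ^ j * exp (-t) * t ^ lam : ℝ) : ℂ) * w‖ ≤
      C * (t ^ lam * exp (-(1 / 2) * t)) := by
  obtain ⟨C, hC, h⟩ := one_add_pow_le_exp (j + m) (b := 1 / 2) (by norm_num)
  refine ⟨C, hC, fun t ht w hw => ?_⟩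
  rw [norm_mul, Complex.norm_real, Real.norm_eq_abs, abs_mul, abs_mul, abs_pow,
    abs_neg, abs_of_pos ht, Real.abs_exp, abs_of_nonneg (Real.rpow_nonneg ht.le _)]
  have hrp := Real.rpow_nonneg ht.le lam
  calc t ^ j * exp (-t) * t ^ lam * ‖w‖ ≤ (1 + t) ^ j * exp (-t) * t ^ lam * (1 + t) ^ m := by
        gcongr; linarith
    _ = (1 + t) ^ (j + m) * (t ^ lam * exp (-t)) := by rw [pow_add]; ring
    _ ≤ C * exp (1 / 2 * t) * (t ^ lam * exp (-t)) := by gcongr; exact h t ht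
    _ = C * (t ^ lam * (exp (1 / 2 * t) * exp (-t))) := by ring
    _ = _ := by rw [← Real.exp_add]; ring_nf

lemma aestronglyMeasurable_rescaled (lam : ℝ) (j : ℕ) {w : ℝ → ℂ}
    (hw : ContinuousOn w (Ioi 0)) :
    AEStronglyMeasurable (fun t => (((-t) ^ j * exp (-t) * t ^ lam : ℝ) : ℂ) * w t)
      (volume.restrict (Ioi 0)) := by
  have h : ContinuousOn (fun r : ℝ => r ^ lam) (Ioi 0) := fun r hr =>
    (Real.continuousAt_rpow_const r lam (Or.inl (ne_of_gt hr))).continuousWithinAt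
  refine ContinuousOn.aestronglyMeasurable (ContinuousOn.mul
    (Complex.continuous_ofReal.comp_continuousOn (ContinuousOn.mul (by fun_prop) h)) hw)
    measurableSet_Ioi

lemma tendsto_hankelMoment_atTop {lam : ℝ} (hl : -1 < lam) (j : ℕ) :
    Tendsto (fun x : ℝ => ((x ^ (lam + 1) * x ^ j : ℝ) : ℂ) * hankelMoment lam j x) atTop
      (𝓝 ((∫ t in Ioi (0 : ℝ), (-t) ^ j * exp (-t) * t ^ lam : ℝ) : ℂ)) := by
  obtain ⟨C, hC, hb⟩ := exists_rescaled_bound lam j ⌈|lam|⌉₊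
  refine Tendsto.congr' ((eventually_gt_atTop 0).mono fun x hx =>
    (rpow_mul_hankelMoment lam j hx).symm) ?_
  rw [← integral_complex_ofReal]
  refine tendsto_integral_filter_of_dominated_convergence
    (fun t => C * (t ^ lam * exp (-(1 / 2) * t))) ?_ ?_
    ((integrableOn_rpow_mul_exp hl (by norm_num)).const_mul C) ?_
  · refine Eventually.of_forall fun x => aestronglyMeasurable_rescaled lam j
      (Continuous.continuousOn ?_)
    exact Continuous.cpow (by fun_prop) (by fun_prop) fun r => one_add_mul_I_mem_slitPlane _
  · filter_upwards [eventually_ge_atTop 1] with x hx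
    filter_upwards [ae_restrict_mem measurableSet_Ioi] with t ht
    have ht : 0 < t := ht
    have hx0 : 0 < x := by linarith
    refine hb t ht _ ((norm_one_add_mul_I_cpow_le lam (by positivity)).trans ?_)
    have h1 : t / x ≤ t := div_le_self ht.le hx
    gcongr
    linarith
  · refine Eventually.of_forall fun t => ?_
    have h1 : Tendsto (fun x : ℝ => 1 + ((t / x / 2 : ℝ) : ℂ) * Complex.I) atTop (𝓝 1) := by
      have h2 : Tendsto (fun x : ℝ => t / x / 2) atTop (𝓝 0) := by
        simpa using (tendsto_const_nhds.div_atTop tendsto_id : Tendsto (fun x : ℝ => t / x)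
          atTop (𝓝 0)).div_const 2
      have h3 := ((Complex.continuous_ofReal.tendsto 0).comp h2).mul_const Complex.I
      simpa using h3.const_add 1
    have h4 := (continuousAt_cpow_const (a := 1) (b := (lam : ℂ)) (by simp)).tendsto.comp h1
    have h5 := h4.const_mul (((-t) ^ j * exp (-t) * t ^ lam : ℝ) : ℂ)
    simpa only [Function.comp_apply, Complex.one_cpow, mul_one] using h5

lemma tendsto_hankelMoment_zero {lam : ℝ} (hl : 0 ≤ lam) :
    Tendsto (fun x : ℝ => ((x ^ (2 * lam + 1) : ℝ) : ℂ) * hankelMoment lam 0 x) (𝓝[>] 0)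
      (𝓝 (((∫ t in Ioi (0 : ℝ), exp (-t) * t ^ lam * (t / 2) ^ lam : ℝ) : ℂ) *
        Complex.I ^ (lam : ℂ))) := by
  obtain ⟨C, hC, hb⟩ := exists_rescaled_bound lam 0 ⌈|lam|⌉₊
  have hrw : ∀ᶠ x : ℝ in 𝓝[>] 0, ∫ t in Ioi (0 : ℝ), (((-t) ^ 0 * exp (-t) * t ^ lam : ℝ) : ℂ) *
      ((x : ℂ) + ((t / 2 : ℝ) : ℂ) * Complex.I) ^ (lam : ℂ) =
        ((x ^ (2 * lam + 1) : ℝ) : ℂ) * hankelMoment lam 0 x := by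
    filter_upwards [self_mem_nhdsWithin] with x hx
    have hx : 0 < x := hx
    have h := rpow_mul_hankelMoment lam 0 hx
    have h2 : x ^ (2 * lam + 1) = x ^ lam * (x ^ (lam + 1) * x ^ 0) := by
      rw [pow_zero, mul_one, ← Real.rpow_add hx]; ring_nf
    rw [h2, Complex.ofReal_mul, mul_assoc, h, ← MeasureTheory.integral_const_mul]
    refine setIntegral_congr_fun measurableSet_Ioi fun t ht => ?_
    rw [mul_left_comm, ofReal_rpow_mul_cpow hx
      (Complex.slitPlane_ne_zero (one_add_mul_I_mem_slitPlane _))]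
    congr 2
    have hx' : (x : ℂ) ≠ 0 := Complex.ofReal_ne_zero.2 hx.ne'
    push_cast
    field_simp
  refine Tendsto.congr' hrw ?_
  rw [← integral_complex_ofReal, ← MeasureTheory.integral_mul_const]
  refine tendsto_integral_filter_of_dominated_convergence
    (fun t => C * (t ^ lam * exp (-(1 / 2) * t))) ?_ ?_
    ((integrableOn_rpow_mul_exp (by linarith) (by norm_num)).const_mul C) ?_
  · refine Eventually.of_forall fun x => aestronglyMeasurable_rescaled lam 0 ?_
    refine ContinuousOn.cpow (by fun_prop) (by fun_prop) fun t ht => Or.inr ?_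
    have : 0 < t := ht
    simp [this.ne']
  · have h1 : ∀ᶠ x : ℝ in 𝓝[>] 0, x ≤ 1 :=
      (eventually_le_nhds one_pos).filter_mono nhdsWithin_le_nhds
    filter_upwards [self_mem_nhdsWithin, h1] with x hx hx1
    have hx : 0 < x := hx
    filter_upwards [ae_restrict_mem measurableSet_Ioi] with t ht
    have ht : 0 < t := ht
    refine hb t ht _ (norm_cpow_le_of_norm_le ?_ (by linarith) (Or.inr hl))
    refine (norm_add_le _ _).trans ?_
    simp only [norm_mul, Complex.norm_real, Complex.norm_I, Real.norm_eq_abs, mul_one]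
    rw [abs_of_pos hx, abs_of_pos (half_pos ht)]
    linarith
  · filter_upwards [ae_restrict_mem measurableSet_Ioi] with t ht
    have ht : 0 < t := ht
    have h1 : Tendsto (fun x : ℝ => (x : ℂ) + ((t / 2 : ℝ) : ℂ) * Complex.I) (𝓝[>] 0)
        (𝓝 (((t / 2 : ℝ) : ℂ) * Complex.I)) := by
      have h2 := (((Complex.continuous_ofReal.tendsto 0).mono_left
        (nhdsWithin_le_nhds (s := Ioi (0 : ℝ)))).add_const (((t / 2 : ℝ) : ℂ) * Complex.I))
      simpa only [Complex.ofReal_zero, zero_add] using h2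
    have h4 := (continuousAt_cpow_const (a := ((t / 2 : ℝ) : ℂ) * Complex.I) (b := (lam : ℂ))
      (Or.inr (by simp [ht.ne']))).tendsto.comp h1
    have h5 := h4.const_mul (((-t) ^ 0 * exp (-t) * t ^ lam : ℝ) : ℂ)
    rw [← ofReal_rpow_mul_cpow (half_pos ht) Complex.I_ne_zero, ← mul_assoc,
      ← Complex.ofReal_mul, pow_zero, one_mul] at h5
    simpa using h5

lemma I_cpow_ofReal (lam : ℝ) : Complex.I ^ (lam : ℂ) = Complex.exp ((lam * π / 2 : ℝ) * Complex.I) := by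
  rw [Complex.cpow_def_of_ne_zero Complex.I_ne_zero, Complex.log_I]
  push_cast
  ring_nf

lemma integral_weight_pos {lam : ℝ} (hl : -1 < lam) :
    0 < ∫ t in Ioi (0 : ℝ), (-t) ^ 0 * exp (-t) * t ^ lam := by
  have h := Real.Gamma_eq_integral (s := lam + 1) (by linarith)
  simp only [add_sub_cancel_right] at h
  simp only [pow_zero, one_mul]
  rw [← h]
  exact Real.Gamma_pos_of_pos (by linarith)

lemma integral_weight_two_pos {lam : ℝ} (hl : 0 ≤ lam) :
    0 < ∫ t in Ioi (0 : ℝ), exp (-t) * t ^ lam * (t / 2) ^ lam := by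
  have h := Real.Gamma_eq_integral (s := 2 * lam + 1) (by linarith)
  simp only [add_sub_cancel_right] at h
  have : ∫ t in Ioi (0 : ℝ), exp (-t) * t ^ lam * (t / 2) ^ lam =
      ∫ t in Ioi (0 : ℝ), (1 / 2) ^ lam * (exp (-t) * t ^ (2 * lam)) := by
    refine setIntegral_congr_fun measurableSet_Ioi fun t ht => ?_
    have ht : 0 < t := ht
    rw [div_eq_mul_one_div, Real.mul_rpow ht.le (by norm_num), two_mul, Real.rpow_add ht]
    ring
  rw [this, MeasureTheory.integral_const_mul, ← h]
  have := Real.Gamma_pos_of_pos (show 0 < 2 * lam + 1 by linarith)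
  positivity

/-- The logarithmic derivative of the Hankel function in the logarithmic variable, expressed
through the modulus. -/
noncomputable def riccati (ν s : ℝ) : ℂ :=
  (((mod1 ν s / 2 : ℝ) : ℂ) + ((2 / π : ℝ) : ℂ) * Complex.I) / ((mod0 ν s : ℝ) : ℂ)

lemma hasDerivAt_riccati (ν s : ℝ) :
    HasDerivAt (riccati ν) (-(riccati ν s) ^ 2 - ((exp s ^ 2 - ν ^ 2 : ℝ) : ℂ)) s := by
  have hn : ((mod0 ν s : ℝ) : ℂ) ≠ 0 := Complex.ofReal_ne_zero.2 (mod0_pos ν s).ne'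
  have h := ((((hasDerivAt_mod1 ν s).div_const 2).ofReal_comp).add_const
    (((2 / π : ℝ) : ℂ) * Complex.I)).div (hasDerivAt_mod0 ν s).ofReal_comp hn
  refine h.congr_deriv ?_
  have he := congrArg (fun y : ℝ => (y : ℂ)) (mod_energy ν s)
  rw [riccati]
  generalize (2 / π : ℝ) = k at *
  push_cast at he ⊢
  field_simp
  linear_combination he + 4 * (k : ℂ) ^ 2 * Complex.I_sq

lemma riccati_re (ν s : ℝ) : (riccati ν s).re = mod1 ν s / 2 / mod0 ν s := by
  rw [riccati, Complex.div_ofReal_re]; simp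

lemma riccati_im (ν s : ℝ) : (riccati ν s).im = 2 / π / mod0 ν s := by
  rw [riccati, Complex.div_ofReal_im]; simp

lemma hasDerivAt_norm_sq_of_eq_mul {f : ℝ → ℂ} {c : ℂ} {s : ℝ} (h : HasDerivAt f (c * f s) s) :
    HasDerivAt (fun s => ‖f s‖ ^ 2) (2 * c.re * ‖f s‖ ^ 2) s := by
  refine h.norm_sq.congr_deriv ?_
  rw [Complex.inner, ← Complex.normSq_eq_norm_sq, Complex.normSq_apply]
  simp
  ring

lemma hasDerivAt_hankelMoment_exp {ν : ℝ} (hν : 0 ≤ ν) (j : ℕ) (s : ℝ) :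
    HasDerivAt (fun s => hankelMoment (ν - 1 / 2) j (exp s))
      (exp s * hankelMoment (ν - 1 / 2) (j + 1) (exp s)) s := by
  have h := (hasDerivAt_hankelMoment (lam := ν - 1 / 2) (by linarith) j
    (Real.exp_pos s)).scomp s (Real.hasDerivAt_exp s)
  refine h.congr_deriv ?_
  rw [Complex.real_smul]

/-- The defect in the first-order equation satisfied by the Hankel function. -/
noncomputable def defect (ν s : ℝ) : ℂ :=
  exp s * hankelMoment (ν - 1 / 2) 1 (exp s) +
    (exp s * Complex.I + ν - riccati ν s) * hankelMoment (ν - 1 / 2) 0 (exp s)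

lemma hasDerivAt_defect {ν : ℝ} (hν : 0 ≤ ν) (s : ℝ) :
    HasDerivAt (defect ν) (-(riccati ν s + ν + exp s * Complex.I) * defect ν s) s := by
  have he := (Real.hasDerivAt_exp s).ofReal_comp
  have h := (he.mul (hasDerivAt_hankelMoment_exp hν 1 s)).add
    ((((he.mul_const Complex.I).add_const (ν : ℂ)).sub (hasDerivAt_riccati ν s)).mul
      (hasDerivAt_hankelMoment_exp hν 0 s))
  refine h.congr_deriv ?_
  have hb := hankelMoment_bessel (lam := ν - 1 / 2) (by linarith) (Real.exp_pos s)
  simp only [Pi.sub_apply, defect, zero_add, one_add_one_eq_two]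
  clear h he
  generalize exp s = x at *
  push_cast at hb ⊢
  linear_combination (x : ℂ) * hb + (x : ℂ) ^ 2 * hankelMoment (ν - 1 / 2) 0 x * Complex.I_sq

lemma tendsto_scaled_hankelMoment_zero {ν : ℝ} (hν : 0 ≤ ν) :
    Tendsto (fun s => ((exp s ^ (ν + 1 / 2) : ℝ) : ℂ) * hankelMoment (ν - 1 / 2) 0 (exp s)) atTop
      (𝓝 ((∫ t in Ioi (0 : ℝ), (-t) ^ 0 * exp (-t) * t ^ (ν - 1 / 2) : ℝ) : ℂ)) := by
  have h := (tendsto_hankelMoment_atTop (lam := ν - 1 / 2) (by linarith) 0).comp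
    Real.tendsto_exp_atTop
  refine h.congr fun s => ?_
  simp only [Function.comp_apply, pow_zero, mul_one]
  rw [show ν - 1 / 2 + 1 = ν + 1 / 2 by ring]

lemma tendsto_scaled_hankelMoment_one {ν : ℝ} (hν : 0 ≤ ν) :
    Tendsto (fun s => ((exp s ^ (ν + 1 / 2) : ℝ) : ℂ) * hankelMoment (ν - 1 / 2) 1 (exp s)) atTop
      (𝓝 0) := by
  have h := (tendsto_hankelMoment_atTop (lam := ν - 1 / 2) (by linarith) 1).comp
    Real.tendsto_exp_atTop
  have h2 := ((Complex.continuous_ofReal.tendsto 0).comp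
    (Real.tendsto_exp_neg_atTop_nhds_zero)).mul h
  simp only [Complex.ofReal_zero, zero_mul] at h2
  refine h2.congr fun s => ?_
  simp only [Function.comp_apply, pow_one]
  rw [show ν - 1 / 2 + 1 = ν + 1 / 2 by ring, ← mul_assoc, ← Complex.ofReal_mul, mul_left_comm,
    ← Real.exp_add, neg_add_cancel, Real.exp_zero, mul_one]

lemma tendsto_riccati_div_exp (ν : ℝ) :
    Tendsto (fun s => riccati ν s / (exp s : ℂ)) atTop (𝓝 Complex.I) := by
  have hk : ((2 / π : ℝ) : ℂ) ≠ 0 := Complex.ofReal_ne_zero.2 (by positivity)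
  have h1 := (((Complex.continuous_ofReal.tendsto _).comp
    ((tendsto_mod1_atTop ν).div_const 2)).add_const (((2 / π : ℝ) : ℂ) * Complex.I)).div
    ((Complex.continuous_ofReal.tendsto _).comp (tendsto_exp_mul_mod0 ν)) hk
  rw [zero_div, Complex.ofReal_zero, zero_add, mul_div_cancel_left₀ _ hk] at h1
  refine h1.congr fun s => ?_
  simp only [Function.comp_apply, riccati, Pi.div_apply]
  rw [div_div, ← Complex.ofReal_mul, mul_comm (mod0 ν s)]

lemma tendsto_scaled_defect {ν : ℝ} (hν : 0 ≤ ν) :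
    Tendsto (fun s => ((exp s ^ (ν + 1 / 2) : ℝ) : ℂ) * (defect ν s / (exp s : ℂ))) atTop
      (𝓝 0) := by
  have hc : Tendsto (fun s : ℝ => Complex.I + (ν : ℂ) * ((exp (-s) : ℝ) : ℂ) -
      riccati ν s / (exp s : ℂ)) atTop (𝓝 0) := by
    have h := (((((Complex.continuous_ofReal.tendsto 0).comp
      (Real.tendsto_exp_neg_atTop_nhds_zero)).const_mul (ν : ℂ)).const_add Complex.I).sub
      (tendsto_riccati_div_exp ν))
    simpa using h
  have h := (tendsto_scaled_hankelMoment_one hν).add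
    (hc.mul (tendsto_scaled_hankelMoment_zero hν))
  rw [zero_mul, add_zero] at h
  refine h.congr fun s => ?_
  have he : (exp s : ℂ) ≠ 0 := Complex.ofReal_ne_zero.2 (Real.exp_pos s).ne'
  rw [defect, Real.exp_neg]
  push_cast
  field_simp

lemma defect_eq_zero {ν : ℝ} (hν : 0 ≤ ν) (s : ℝ) : defect ν s = 0 := by
  have key : exp (2 * ν * s) * mod0 ν s * ‖defect ν s‖ ^ 2 = 0 := by
    refine eq_of_deriv_zero_of_tendsto
      (f := fun s => exp (2 * ν * s) * mod0 ν s * ‖defect ν s‖ ^ 2) (fun s => ?_) ?_ s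
    · have h1 : HasDerivAt (fun s : ℝ => exp (2 * ν * s)) (exp (2 * ν * s) * (2 * ν * 1)) s :=
        ((hasDerivAt_id s).const_mul (2 * ν)).exp
      have h := (h1.mul (hasDerivAt_mod0 ν s)).mul
        (hasDerivAt_norm_sq_of_eq_mul (hasDerivAt_defect hν s))
      refine h.congr_deriv ?_
      have hr := riccati_re ν s
      have hn := (mod0_pos ν s).ne'
      simp only [Pi.mul_apply, Complex.neg_re, Complex.add_re, hr, Complex.ofReal_re,
        Complex.re_ofReal_mul, Complex.I_re]
      field_simp
      ring
    · have h := (tendsto_exp_mul_mod0 ν).mul ((tendsto_scaled_defect hν).norm.pow 2)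
      simp only [norm_zero, ne_eq, OfNat.ofNat_ne_zero, not_false_eq_true, zero_pow, mul_zero] at h
      refine h.congr fun s => ?_
      have he := Real.exp_pos s
      rw [norm_mul, norm_div, Complex.norm_real, Complex.norm_real, Real.norm_eq_abs,
        Real.norm_eq_abs, Real.abs_exp, abs_of_pos (by positivity), ← Real.exp_mul, mul_pow,
        div_pow, ← Real.exp_nat_mul]
      have : exp (2 * ν * s) = exp (((2 : ℕ) : ℝ) * (s * (ν + 1 / 2))) / exp s := by
        rw [← Real.exp_sub]; push_cast; ring_nf
      rw [this]
      field_simp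
  have hn := mod0_pos ν s
  have he := Real.exp_pos (2 * ν * s)
  have h0 : ‖defect ν s‖ ^ 2 = 0 := by
    rcases mul_eq_zero.1 key with h | h
    · exact absurd h (by positivity)
    · exact h
  exact norm_eq_zero.1 (pow_eq_zero_iff (two_ne_zero) |>.1 h0)

lemma hasDerivAt_hankel {ν : ℝ} (hν : 0 ≤ ν) (s : ℝ) :
    HasDerivAt (fun s => hankelMoment (ν - 1 / 2) 0 (exp s))
      ((riccati ν s - ν - exp s * Complex.I) * hankelMoment (ν - 1 / 2) 0 (exp s)) s := by
  refine (hasDerivAt_hankelMoment_exp hν 0 s).congr_deriv ?_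
  have := defect_eq_zero hν s
  rw [defect] at this
  linear_combination this

lemma exists_hankel_norm_sq {ν : ℝ} (hν : 0 ≤ ν) : ∃ c, 0 < c ∧ ∀ s,
    exp (2 * ν * s) * ‖hankelMoment (ν - 1 / 2) 0 (exp s)‖ ^ 2 / mod0 ν s = c := by
  have hg := integral_weight_pos (lam := ν - 1 / 2) (by linarith)
  suffices hlim : Tendsto (fun s =>
      exp (2 * ν * s) * ‖hankelMoment (ν - 1 / 2) 0 (exp s)‖ ^ 2 / mod0 ν s) atTop
      (𝓝 ((∫ t in Ioi (0 : ℝ), (-t) ^ 0 * exp (-t) * t ^ (ν - 1 / 2)) ^ 2 / (2 / π))) by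
    refine ⟨_, by positivity, fun s => eq_of_deriv_zero_of_tendsto (fun s => ?_) hlim s⟩
    have h1 : HasDerivAt (fun s : ℝ => exp (2 * ν * s)) (exp (2 * ν * s) * (2 * ν * 1)) s :=
      ((hasDerivAt_id s).const_mul (2 * ν)).exp
    have hn := (mod0_pos ν s).ne'
    have h := (h1.mul (hasDerivAt_norm_sq_of_eq_mul (hasDerivAt_hankel hν s))).div
      (hasDerivAt_mod0 ν s) hn
    refine h.congr_deriv ?_
    have hr := riccati_re ν s
    simp only [Pi.mul_apply, Complex.sub_re, hr, Complex.ofReal_re,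
      Complex.re_ofReal_mul, Complex.I_re]
    field_simp
    ring
  have h := ((tendsto_scaled_hankelMoment_zero hν).norm.pow 2).div (tendsto_exp_mul_mod0 ν)
    (by positivity)
  rw [Complex.norm_real, Real.norm_eq_abs, abs_of_pos hg] at h
  refine h.congr fun s => ?_
  have he := Real.exp_pos s
  have hn := (mod0_pos ν s).ne'
  simp only [Pi.div_apply]
  rw [norm_mul, Complex.norm_real, Real.norm_eq_abs, abs_of_pos (by positivity),
    ← Real.exp_mul, mul_pow, ← Real.exp_nat_mul]
  have : exp (2 * ν * s) = exp (((2 : ℕ) : ℝ) * (s * (ν + 1 / 2))) / exp s := by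
    rw [← Real.exp_sub]; push_cast; ring_nf
  rw [this]
  field_simp

lemma hankel_ne_zero {ν : ℝ} (hν : 0 ≤ ν) (s : ℝ) : hankelMoment (ν - 1 / 2) 0 (exp s) ≠ 0 := by
  obtain ⟨c, hc, h⟩ := exists_hankel_norm_sq hν
  intro h0
  have := h s
  rw [h0] at this
  simp at this
  exact hc.ne this

lemma apply_hankelMoment_nonneg {lam x : ℝ} (hl : -1 < lam) (hx : 0 < x) (L : ℂ →L[ℝ] ℝ)
    (h : ∀ r, 0 < r → 0 ≤ L ((1 + ((r / 2 : ℝ) : ℂ) * Complex.I) ^ (lam : ℂ))) :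
    0 ≤ L (hankelMoment lam 0 x) := by
  rw [hankelMoment, ← L.integral_comp_comm (integrableOn_hankelKernel hl 0 hx)]
  refine setIntegral_nonneg measurableSet_Ioi fun r hr => ?_
  have hr : 0 < r := hr
  rw [hankelKernel, ← Complex.real_smul, map_smul, smul_eq_mul]
  exact mul_nonneg (by positivity) (h r hr)

lemma arg_one_add_mul_I_mem {y : ℝ} (hy : 0 < y) :
    0 ≤ Complex.arg (1 + (y : ℂ) * Complex.I) ∧ Complex.arg (1 + (y : ℂ) * Complex.I) ≤ π / 2 := by
  constructor
  · rw [Complex.arg_nonneg_iff]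
    simp [hy.le]
  · rw [Complex.arg_le_pi_div_two_iff]
    simp

lemma cos_mul_arg_nonneg {lam a : ℝ} (h1 : -(1 / 2) ≤ lam) (h2 : lam ≤ 0) (ha : 0 ≤ a)
    (ha' : a ≤ π / 2) : 0 ≤ cos (a * lam) :=
  Real.cos_nonneg_of_neg_pi_div_two_le_of_le (by nlinarith [Real.pi_pos])
    (by nlinarith [Real.pi_pos])

lemma hankelMoment_re_nonneg {lam x : ℝ} (h1 : -(1 / 2) ≤ lam) (h2 : lam ≤ 0) (hx : 0 < x) :
    0 ≤ (hankelMoment lam 0 x).re := by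
  refine apply_hankelMoment_nonneg (by linarith) hx Complex.reCLM fun r hr => ?_
  obtain ⟨ha, ha'⟩ := arg_one_add_mul_I_mem (half_pos hr)
  rw [Complex.cpow_ofReal, Complex.reCLM_apply, Complex.re_ofReal_mul]
  refine mul_nonneg (by positivity) ?_
  simpa only [Complex.add_re, Complex.ofReal_re, Complex.re_ofReal_mul, Complex.I_re, mul_zero,
    add_zero] using cos_mul_arg_nonneg h1 h2 ha ha'

lemma hankelMoment_im_nonpos {lam x : ℝ} (h1 : -(1 / 2) ≤ lam) (h2 : lam ≤ 0) (hx : 0 < x) :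
    (hankelMoment lam 0 x).im ≤ 0 := by
  have := apply_hankelMoment_nonneg (lam := lam) (by linarith) hx (-Complex.imCLM) fun r hr => ?_
  · simpa using this
  · obtain ⟨ha, ha'⟩ := arg_one_add_mul_I_mem (half_pos hr)
    rw [Complex.cpow_ofReal, neg_apply, Complex.imCLM_apply,
      Complex.im_ofReal_mul, ← mul_neg]
    refine mul_nonneg (by positivity) ?_
    have : sin (Complex.arg (1 + ((r / 2 : ℝ) : ℂ) * Complex.I) * lam) ≤ 0 :=
      Real.sin_nonpos_of_nonpos_of_neg_pi_le (by nlinarith [Real.pi_pos])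
        (by nlinarith [Real.pi_pos])
    rw [Complex.add_im, Complex.ofReal_im, zero_add,
      Complex.im_ofReal_mul, Complex.I_im, mul_one]
    linarith

lemma hankelMoment_rotated_im_nonneg {lam x : ℝ} (h1 : -(1 / 2) ≤ lam) (h2 : lam ≤ 0)
    (hx : 0 < x) : 0 ≤ cos (lam * π / 2) * (hankelMoment lam 0 x).im -
      sin (lam * π / 2) * (hankelMoment lam 0 x).re := by
  have := apply_hankelMoment_nonneg (lam := lam) (by linarith) hx
    (cos (lam * π / 2) • Complex.imCLM - sin (lam * π / 2) • Complex.reCLM) fun r hr => ?_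
  · simpa using this
  · obtain ⟨ha, ha'⟩ := arg_one_add_mul_I_mem (half_pos hr)
    generalize hA : Complex.arg (1 + ((r / 2 : ℝ) : ℂ) * Complex.I) = a at ha ha'
    rw [Complex.cpow_ofReal, hA, sub_apply, smul_apply,
      smul_apply, Complex.imCLM_apply, Complex.reCLM_apply,
      Complex.im_ofReal_mul, Complex.re_ofReal_mul, smul_eq_mul, smul_eq_mul]
    simp only [Complex.add_im, Complex.add_re, Complex.ofReal_im, Complex.ofReal_re,
      Complex.im_ofReal_mul, Complex.re_ofReal_mul, Complex.I_im, Complex.I_re]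
    have hs : 0 ≤ sin (a * lam - lam * π / 2) :=
      Real.sin_nonneg_of_nonneg_of_le_pi (by nlinarith [Real.pi_pos]) (by nlinarith [Real.pi_pos])
    rw [Real.sin_sub] at hs
    have hm := mul_nonneg (Real.rpow_nonneg (norm_nonneg (1 + ((r / 2 : ℝ) : ℂ) * Complex.I)) lam) hs
    linarith

lemma cos_half_mul_pi_pos {lam : ℝ} (h1 : -(1 / 2) ≤ lam) (h2 : lam ≤ 0) :
    0 < cos (lam * π / 2) :=
  Real.cos_pos_of_mem_Ioo ⟨by nlinarith [Real.pi_pos], by nlinarith [Real.pi_pos]⟩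

lemma hankelMoment_re_pos {lam x : ℝ} (h1 : -(1 / 2) ≤ lam) (h2 : lam ≤ 0) (hx : 0 < x) :
    0 < (hankelMoment lam 0 x).re := by
  refine lt_of_le_of_ne (hankelMoment_re_nonneg h1 h2 hx) fun h0 => ?_
  have hi := hankelMoment_im_nonpos h1 h2 hx
  have hr := hankelMoment_rotated_im_nonneg h1 h2 hx
  rw [← h0, mul_zero, sub_zero] at hr
  have hi2 := nonneg_of_mul_nonneg_right hr (cos_half_mul_pi_pos h1 h2)
  have hne := hankel_ne_zero (ν := lam + 1 / 2) (by linarith) (Real.log x)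
  rw [Real.exp_log hx, add_sub_cancel_right] at hne
  exact hne (Complex.ext h0.symm (le_antisymm hi hi2))

lemma hankelMoment_arg_nonpos {lam x : ℝ} (h1 : -(1 / 2) ≤ lam) (h2 : lam ≤ 0) (hx : 0 < x) :
    Complex.arg (hankelMoment lam 0 x) ≤ 0 := by
  have hre := hankelMoment_re_pos h1 h2 hx
  rcases (hankelMoment_im_nonpos h1 h2 hx).lt_or_eq with h | h
  · exact (Complex.arg_neg_iff.2 h).le
  · exact (Complex.arg_eq_zero_iff.2 ⟨hre.le, h⟩).le

lemma le_hankelMoment_arg {lam x : ℝ} (h1 : -(1 / 2) ≤ lam) (h2 : lam ≤ 0) (hx : 0 < x) :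
    lam * π / 2 ≤ Complex.arg (hankelMoment lam 0 x) := by
  by_contra! hlt
  have hre := hankelMoment_re_pos h1 h2 hx
  have hr := hankelMoment_rotated_im_nonneg h1 h2 hx
  have hgt : -(π / 2) < Complex.arg (hankelMoment lam 0 x) :=
    (abs_lt.1 (Complex.abs_arg_lt_pi_div_two_iff.2 (Or.inl hre))).1
  have hn : 0 < ‖hankelMoment lam 0 x‖ := norm_pos_iff.2 fun h => by simp [h] at hre
  have hs : sin (Complex.arg (hankelMoment lam 0 x) - lam * π / 2) < 0 :=
    Real.sin_neg_of_neg_of_neg_pi_lt (by linarith) (by nlinarith [Real.pi_pos])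
  rw [Real.sin_sub] at hs
  rw [← Complex.norm_mul_sin_arg, ← Complex.norm_mul_cos_arg] at hr
  have := mul_neg_of_pos_of_neg hn hs
  linarith

/-- The integrand of the Bessel phase. -/
noncomputable def phaseDensity (ν u : ℝ) : ℝ := 1 / (u * M2 ν u)

lemma M2_eq {ν u : ℝ} (hu : 0 < u) : M2 ν u = mod0 ν (Real.log u) := by
  rw [← M2_exp, Real.exp_log hu]

lemma M2_pos (ν : ℝ) {u : ℝ} (hu : 0 < u) : 0 < M2 ν u := by
  rw [M2_eq hu]; exact mod0_pos _ _

lemma phaseDensity_pos (ν : ℝ) {u : ℝ} (hu : 0 < u) : 0 < phaseDensity ν u := by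
  have := M2_pos ν hu
  unfold phaseDensity
  positivity

lemma phaseDensity_anti {μ ν u : ℝ} (hμ : 0 ≤ μ) (h : μ ≤ ν) (hu : 0 < u) :
    phaseDensity ν u ≤ phaseDensity μ u := by
  have := M2_pos μ hu
  have h2 : M2 μ u ≤ M2 ν u := by
    rw [M2_eq hu, M2_eq hu]; exact mod0_mono hμ h _
  unfold phaseDensity
  gcongr

lemma continuousAt_phaseDensity (ν : ℝ) {u : ℝ} (hu : 0 < u) :
    ContinuousAt (phaseDensity ν) u := by
  have h : ContinuousAt (fun u => 1 / (u * mod0 ν (Real.log u))) u := by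
    refine ContinuousAt.div continuousAt_const (continuousAt_id.mul
      (((hasDerivAt_mod0 ν _).continuousAt).comp (Real.continuousAt_log hu.ne'))) ?_
    exact (mul_pos hu (mod0_pos _ _)).ne'
  refine h.congr ?_
  filter_upwards [eventually_gt_nhds hu] with v hv
  rw [phaseDensity, M2_eq hv]

lemma continuousOn_phaseDensity (ν : ℝ) : ContinuousOn (phaseDensity ν) (Ioi 0) :=
  fun _ hu => (continuousAt_phaseDensity ν hu).continuousWithinAt

lemma intervalIntegrable_phaseDensity_of_pos (ν : ℝ) {a b : ℝ} (ha : 0 < a) (hb : 0 < b) :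
    IntervalIntegrable (phaseDensity ν) volume a b :=
  ((continuousOn_phaseDensity ν).mono fun _ hx => lt_of_lt_of_le (lt_min ha hb) hx.1).intervalIntegrable

lemma hasDerivAt_arg_hankel {ν x : ℝ} (hν : 0 ≤ ν) (hν' : ν ≤ 1 / 2) (hx : 0 < x) :
    HasDerivAt (fun x => Complex.arg (hankelMoment (ν - 1 / 2) 0 x) + x)
      (2 / π * phaseDensity ν x) x := by
  have hre := hankelMoment_re_pos (lam := ν - 1 / 2) (by linarith) (by linarith) hx
  have hd := hasDerivAt_hankelMoment (lam := ν - 1 / 2) (by linarith) 0 hx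
  have h1 := hd.clog_real (Or.inl hre)
  have h2 := (Complex.imCLM.hasFDerivAt.comp_hasDerivAt x h1).add (hasDerivAt_id x)
  refine (h2.congr_deriv ?_).congr_of_eventuallyEq (Eventually.of_forall fun y => ?_)
  · have hdef := defect_eq_zero hν (Real.log x)
    rw [defect, Real.exp_log hx] at hdef
    have hne : hankelMoment (ν - 1 / 2) 0 x ≠ 0 := fun h => by
      rw [h, Complex.zero_re] at hre; exact lt_irrefl _ hre
    have hx' : (x : ℂ) ≠ 0 := Complex.ofReal_ne_zero.2 hx.ne'
    have : hankelMoment (ν - 1 / 2) (0 + 1) x / hankelMoment (ν - 1 / 2) 0 x =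
        (riccati ν (Real.log x) - x * Complex.I - ν) / (x : ℂ) := by
      rw [div_eq_div_iff hne hx']
      linear_combination hdef
    rw [this, Complex.imCLM_apply, Complex.div_ofReal_im]
    simp only [Complex.sub_im, Complex.ofReal_im, Complex.im_ofReal_mul, Complex.I_im, riccati_im]
    rw [phaseDensity, M2_eq hx]
    have := (mod0_pos ν (Real.log x)).ne'
    field_simp
    ring
  · simp [Complex.log_im]

lemma integral_phaseDensity_le {ν a x : ℝ} (hν : 0 ≤ ν) (hν' : ν ≤ 1 / 2) (ha : 0 < a)
    (hx : 0 < x) : 2 / π * ∫ u in a..x, phaseDensity ν u ≤ x + π / 4 - ν * π / 2 := by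
  rw [← intervalIntegral.integral_const_mul, integral_eq_sub_of_hasDerivAt
    (f := fun x => Complex.arg (hankelMoment (ν - 1 / 2) 0 x) + x)
    (fun y hy => hasDerivAt_arg_hankel hν hν' (lt_of_lt_of_le (lt_min ha hx) hy.1))
    ((intervalIntegrable_phaseDensity_of_pos ν ha hx).const_mul _)]
  have h1 := hankelMoment_arg_nonpos (lam := ν - 1 / 2) (by linarith) (by linarith) hx
  have h2 := le_hankelMoment_arg (lam := ν - 1 / 2) (by linarith) (by linarith) ha
  linarith

lemma integrableOn_phaseDensity_of_le {ν x : ℝ} (hν : 0 ≤ ν) (hν' : ν ≤ 1 / 2) (hx : 0 < x) :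
    IntegrableOn (phaseDensity ν) (Ioc 0 x) := by
  have hpos : ∀ n : ℕ, (0 : ℝ) < 1 / ((n : ℝ) + 1) := fun n => by positivity
  have hlim := tendsto_one_div_add_atTop_nhds_zero_nat (𝕜 := ℝ)
  refine integrableOn_Ioc_of_intervalIntegral_norm_bounded_left (l := atTop)
    (a := fun n : ℕ => 1 / ((n : ℝ) + 1)) (I := (x + π / 4 - ν * π / 2) / (2 / π)) (fun n => ?_) hlim ?_
  · exact (intervalIntegrable_phaseDensity_of_pos ν (hpos n) hx).1
  · filter_upwards [hlim.eventually (eventually_le_nhds hx)] with n hn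
    rw [le_div_iff₀' (by positivity)]
    refine le_trans (le_of_eq ?_) (integral_phaseDensity_le hν hν' (hpos n) hx)
    rw [intervalIntegral.integral_of_le hn]
    congr 1
    refine setIntegral_congr_fun measurableSet_Ioc fun u hu => ?_
    exact Real.norm_of_nonneg (phaseDensity_pos ν ((hpos n).trans hu.1)).le

lemma integrableOn_phaseDensity {ν x : ℝ} (hν : 0 ≤ ν) (hx : 0 < x) :
    IntegrableOn (phaseDensity ν) (Ioc 0 x) := by
  refine Integrable.mono' (integrableOn_phaseDensity_of_le (ν := 0) le_rfl (by norm_num) hx)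
    (((continuousOn_phaseDensity ν).mono fun u hu => hu.1).aestronglyMeasurable
      measurableSet_Ioc) ?_
  filter_upwards [ae_restrict_mem measurableSet_Ioc] with u hu
  rw [Real.norm_of_nonneg (phaseDensity_pos ν hu.1).le]
  exact phaseDensity_anti le_rfl hν hu.1

/-- The Bessel phase, shifted to vanish at the origin. -/
noncomputable def shiftedPhase (ν x : ℝ) : ℝ := 2 / π * ∫ u in (0 : ℝ)..x, phaseDensity ν u

lemma phase_eq (ν x : ℝ) : phase ν x = -(π / 2) + shiftedPhase ν x := rfl

lemma intervalIntegrable_phaseDensity {ν x : ℝ} (hν : 0 ≤ ν) (hx : 0 < x) :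
    IntervalIntegrable (phaseDensity ν) volume 0 x :=
  (intervalIntegrable_iff_integrableOn_Ioc_of_le hx.le).2 (integrableOn_phaseDensity hν hx)

lemma hasDerivAt_shiftedPhase {ν x : ℝ} (hν : 0 ≤ ν) (hx : 0 < x) :
    HasDerivAt (shiftedPhase ν) (2 / π * phaseDensity ν x) x := by
  refine (integral_hasDerivAt_right (intervalIntegrable_phaseDensity hν hx) ?_
    (continuousAt_phaseDensity ν hx)).const_mul _
  exact (continuousOn_phaseDensity ν).stronglyMeasurableAtFilter isOpen_Ioi x hx

lemma tendsto_shiftedPhase_zero {ν : ℝ} (hν : 0 ≤ ν) :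
    Tendsto (shiftedPhase ν) (𝓝[>] 0) (𝓝 0) := by
  have h : IntegrableOn (phaseDensity ν) (uIcc 0 1) := by
    rw [uIcc_of_le zero_le_one, integrableOn_Icc_iff_integrableOn_Ioc]
    exact integrableOn_phaseDensity hν one_pos
  have hc := (continuousOn_primitive_interval h) 0 left_mem_uIcc
  rw [uIcc_of_le zero_le_one] at hc
  have h2 := (hc.tendsto.mono_left (show 𝓝[>] (0 : ℝ) ≤ 𝓝[Icc 0 1] 0 by
    rw [← nhdsWithin_Ioc_eq_nhdsGT (one_pos (α := ℝ))]
    exact nhdsWithin_mono _ Ioc_subset_Icc_self)).const_mul (2 / π)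
  rw [integral_same, mul_zero] at h2
  exact h2

lemma shiftedPhase_le {ν x : ℝ} (hν : 0 ≤ ν) (hν' : ν ≤ 1 / 2) (hx : 0 < x) :
    shiftedPhase ν x ≤ x + π / 4 - ν * π / 2 := by
  have h := (tendsto_shiftedPhase_zero hν).const_sub (shiftedPhase ν x)
  rw [sub_zero] at h
  refine le_of_tendsto h ?_
  filter_upwards [self_mem_nhdsWithin] with a ha
  have ha : 0 < a := ha
  rw [shiftedPhase, shiftedPhase, ← mul_sub, integral_interval_sub_left
    (intervalIntegrable_phaseDensity hν hx) (intervalIntegrable_phaseDensity hν ha)]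
  exact integral_phaseDensity_le hν hν' ha hx

lemma shiftedPhase_anti {μ ν x : ℝ} (hμ : 0 ≤ μ) (h : μ ≤ ν) (hx : 0 < x) :
    shiftedPhase ν x ≤ shiftedPhase μ x := by
  unfold shiftedPhase
  refine mul_le_mul_of_nonneg_left ?_ (by positivity)
  rw [intervalIntegral.integral_of_le hx.le, intervalIntegral.integral_of_le hx.le]
  exact setIntegral_mono_on (integrableOn_phaseDensity (hμ.trans h) hx)
    (integrableOn_phaseDensity hμ hx) measurableSet_Ioc fun u hu => phaseDensity_anti hμ h hu.1

lemma hasDerivAt_div_norm_of_eq_mul {f : ℝ → ℂ} {c s : ℝ} (h : HasDerivAt f (c * f s) s)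
    (h0 : f s ≠ 0) : HasDerivAt (fun s => f s / (‖f s‖ : ℂ)) 0 s := by
  have hn : ‖f s‖ ≠ 0 := norm_ne_zero_iff.2 h0
  have hn' : (‖f s‖ : ℂ) ≠ 0 := Complex.ofReal_ne_zero.2 hn
  have h1 : HasDerivAt (fun s => ‖f s‖) (c * ‖f s‖) s := by
    have h2 := (hasDerivAt_norm_sq_of_eq_mul h).sqrt (pow_ne_zero 2 hn)
    simp only [Real.sqrt_sq (norm_nonneg _), Complex.ofReal_re] at h2
    refine h2.congr_deriv ?_
    field_simp
  refine (h.div h1.ofReal_comp hn').congr_deriv ?_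
  push_cast
  field_simp
  ring

lemma hasDerivAt_shiftedPhase_exp {ν : ℝ} (hν : 0 ≤ ν) (s : ℝ) :
    HasDerivAt (fun s => shiftedPhase ν (exp s)) (2 / π / mod0 ν s) s := by
  have h := (hasDerivAt_shiftedPhase hν (Real.exp_pos s)).comp s (Real.hasDerivAt_exp s)
  refine h.congr_deriv ?_
  rw [phaseDensity, M2_exp]
  have := (mod0_pos ν s).ne'
  field_simp

/-- The Hankel function rotated by the Bessel phase. -/
noncomputable def rotatedHankel (ν x : ℝ) : ℂ :=
  Complex.exp ((x - shiftedPhase ν x : ℝ) * Complex.I) * hankelMoment (ν - 1 / 2) 0 x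

lemma hasDerivAt_rotatedHankel {ν : ℝ} (hν : 0 ≤ ν) (s : ℝ) :
    HasDerivAt (fun s => rotatedHankel ν (exp s))
      (((riccati ν s).re - ν : ℝ) * rotatedHankel ν (exp s)) s := by
  have h := ((((Real.hasDerivAt_exp s).sub (hasDerivAt_shiftedPhase_exp hν s)).ofReal_comp.mul_const
    Complex.I).cexp).mul (hasDerivAt_hankel hν s)
  refine h.congr_deriv ?_
  have hr := Complex.re_add_im (riccati ν s)
  simp only [rotatedHankel, Pi.sub_apply]
  rw [← riccati_im, ← hr]
  simp only [Complex.add_re, Complex.add_im, Complex.ofReal_re, Complex.ofReal_im,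
    Complex.re_ofReal_mul, Complex.im_ofReal_mul, Complex.I_re, Complex.I_im]
  push_cast
  ring

lemma rotatedHankel_ne_zero {ν : ℝ} (hν : 0 ≤ ν) (s : ℝ) : rotatedHankel ν (exp s) ≠ 0 :=
  mul_ne_zero (Complex.exp_ne_zero _) (hankel_ne_zero hν s)

lemma exists_rotatedHankel_direction {ν : ℝ} (hν : 0 ≤ ν) : ∃ α : ℂ, ∀ x, 0 < x →
    rotatedHankel ν x / (‖rotatedHankel ν x‖ : ℂ) = α := by
  have hd : ∀ s, HasDerivAt
      (fun s => rotatedHankel ν (exp s) / (‖rotatedHankel ν (exp s)‖ : ℂ)) 0 s := fun s =>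
    hasDerivAt_div_norm_of_eq_mul (hasDerivAt_rotatedHankel hν s) (rotatedHankel_ne_zero hν s)
  refine ⟨rotatedHankel ν (exp 0) / (‖rotatedHankel ν (exp 0)‖ : ℂ), fun x hx => ?_⟩
  have := is_const_of_deriv_eq_zero (fun s => (hd s).differentiableAt) (fun s => (hd s).deriv)
    (Real.log x) 0
  rwa [Real.exp_log hx] at this

lemma rotatedHankel_div_norm (ν : ℝ) {x w : ℝ} (hw : 0 < w) :
    rotatedHankel ν x / (‖rotatedHankel ν x‖ : ℂ) =
      Complex.exp ((x - shiftedPhase ν x : ℝ) * Complex.I) *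
        ((w : ℂ) * hankelMoment (ν - 1 / 2) 0 x / (‖(w : ℂ) * hankelMoment (ν - 1 / 2) 0 x‖ : ℂ)) := by
  have hw' : (w : ℂ) ≠ 0 := Complex.ofReal_ne_zero.2 hw.ne'
  rw [rotatedHankel, norm_mul, Complex.norm_exp_ofReal_mul_I, one_mul, norm_mul, Complex.norm_real,
    Real.norm_of_nonneg hw.le, Complex.ofReal_mul, mul_div_mul_left _ _ hw', mul_div_assoc]

lemma tendsto_div_norm {ι : Type*} {l : Filter ι} {f : ι → ℂ} {z : ℂ} (h : Tendsto f l (𝓝 z))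
    (hz : z ≠ 0) : Tendsto (fun i => f i / (‖f i‖ : ℂ)) l (𝓝 (z / (‖z‖ : ℂ))) :=
  h.div ((Complex.continuous_ofReal.tendsto _).comp h.norm)
    (Complex.ofReal_ne_zero.2 (norm_ne_zero_iff.2 hz))

lemma rotatedHankel_direction {ν : ℝ} (hν : 1 / 2 ≤ ν) {x : ℝ} (hx : 0 < x) :
    rotatedHankel ν x / (‖rotatedHankel ν x‖ : ℂ) =
      Complex.exp (((ν - 1 / 2) * π / 2 : ℝ) * Complex.I) := by
  have hν0 : 0 ≤ ν := by linarith
  obtain ⟨α, hα⟩ := exists_rotatedHankel_direction hν0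
  have hg := integral_weight_two_pos (lam := ν - 1 / 2) (by linarith)
  have hm := tendsto_hankelMoment_zero (lam := ν - 1 / 2) (by linarith)
  rw [I_cpow_ofReal] at hm
  have hd := tendsto_div_norm hm (mul_ne_zero (Complex.ofReal_ne_zero.2 hg.ne')
    (Complex.exp_ne_zero _))
  rw [norm_mul, Complex.norm_exp_ofReal_mul_I, mul_one, Complex.norm_real,
    Real.norm_of_nonneg hg.le, mul_div_cancel_left₀ _ (Complex.ofReal_ne_zero.2 hg.ne')] at hd
  have he : Tendsto (fun x : ℝ => Complex.exp ((x - shiftedPhase ν x : ℝ) * Complex.I)) (𝓝[>] 0)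
      (𝓝 1) := by
    have h0 : Tendsto (fun x : ℝ => x - shiftedPhase ν x) (𝓝[>] 0) (𝓝 (0 - 0)) :=
      (tendsto_id.mono_left nhdsWithin_le_nhds).sub (tendsto_shiftedPhase_zero hν0)
    have h1 := (Complex.continuous_exp.tendsto _).comp
      (((Complex.continuous_ofReal.tendsto _).comp h0).mul_const Complex.I)
    simpa [Function.comp_def] using h1
  have h := he.mul hd
  rw [one_mul] at h
  rw [hα x hx]
  refine tendsto_nhds_unique (tendsto_const_nhds.congr' ?_) h
  filter_upwards [self_mem_nhdsWithin] with y hy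
  have hy : 0 < y := hy
  rw [← hα y hy, rotatedHankel_div_norm ν (Real.rpow_pos_of_pos hy _)]

lemma tendsto_exp_sub_shiftedPhase {ν : ℝ} (hν : 1 / 2 ≤ ν) :
    Tendsto (fun x : ℝ => Complex.exp ((x - shiftedPhase ν x - (ν - 1 / 2) * π / 2 : ℝ) *
      Complex.I)) atTop (𝓝 1) := by
  have hg := integral_weight_pos (lam := ν - 1 / 2) (by linarith)
  have hg' := Complex.ofReal_ne_zero.2 hg.ne'
  have hd := tendsto_div_norm (tendsto_hankelMoment_atTop (lam := ν - 1 / 2) (by linarith) 0) hg'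
  rw [Complex.norm_real, Real.norm_of_nonneg hg.le, div_self hg'] at hd
  have h := hd.inv₀ one_ne_zero
  rw [inv_one] at h
  refine h.congr' ?_
  filter_upwards [eventually_gt_atTop 0] with x hx
  have h1 := rotatedHankel_direction hν hx
  rw [rotatedHankel_div_norm ν (w := x ^ (ν - 1 / 2 + 1) * x ^ 0) (by positivity)] at h1
  rw [Complex.ofReal_sub, sub_mul, Complex.exp_sub, ← h1]
  have hh : ((x ^ (ν - 1 / 2 + 1) * x ^ 0 : ℝ) : ℂ) * hankelMoment (ν - 1 / 2) 0 x /
      (‖((x ^ (ν - 1 / 2 + 1) * x ^ 0 : ℝ) : ℂ) * hankelMoment (ν - 1 / 2) 0 x‖ : ℂ) ≠ 0 := by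
    intro h0
    rw [h0, mul_zero] at h1
    exact Complex.exp_ne_zero _ h1.symm
  rw [div_mul_cancel_left₀ (Complex.exp_ne_zero _)]

/-- The leading term of the Debye expansion of the Bessel phase. -/
noncomputable def debyePhase (ν x : ℝ) : ℝ := Real.sqrt (x ^ 2 - ν ^ 2) - ν * Real.arccos (ν / x)

lemma hasDerivAt_debyePhase {ν x : ℝ} (hν : 0 ≤ ν) (hx : ν < x) :
    HasDerivAt (debyePhase ν) (Real.sqrt (x ^ 2 - ν ^ 2) / x) x := by
  have hx0 : 0 < x := hν.trans_lt hx
  have hpos : 0 < x ^ 2 - ν ^ 2 := by nlinarith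
  have hlt : ν / x < 1 := (div_lt_one hx0).2 hx
  have hgt : -1 < ν / x := lt_of_lt_of_le (by norm_num) (div_nonneg hν hx0.le)
  have h1 : HasDerivAt (fun x => Real.sqrt (x ^ 2 - ν ^ 2))
      (2 * x / (2 * Real.sqrt (x ^ 2 - ν ^ 2))) x :=
    HasDerivAt.sqrt (((hasDerivAt_pow 2 x).sub_const (ν ^ 2)).congr_deriv (by norm_num)) hpos.ne'
  have h2 := ((Real.hasDerivAt_arccos hgt.ne' hlt.ne).comp x
    ((hasDerivAt_const x ν).div (hasDerivAt_id x) hx0.ne')).const_mul ν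
  refine (h1.sub h2).congr_deriv ?_
  have hs : Real.sqrt (1 - (ν / x) ^ 2) = Real.sqrt (x ^ 2 - ν ^ 2) / x := by
    rw [← Real.sqrt_sq hx0.le, ← Real.sqrt_div' _ (sq_nonneg _), Real.sqrt_sq hx0.le]
    congr 1
    field_simp
  have hsq := Real.sq_sqrt hpos.le
  have hs0 := (Real.sqrt_pos.2 hpos).ne'
  rw [hs]
  generalize Real.sqrt (x ^ 2 - ν ^ 2) = w at hsq hs0
  field_simp
  linarith

lemma tendsto_debyePhase_sub {ν : ℝ} (hν : 0 ≤ ν) :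
    Tendsto (fun x => debyePhase ν x - x) atTop (𝓝 (-(ν * π / 2))) := by
  have h1 : Tendsto (fun x => Real.sqrt (x ^ 2 - ν ^ 2) - x) atTop (𝓝 0) := by
    have h0 : Tendsto (fun x : ℝ => -(ν ^ 2 / x)) atTop (𝓝 0) := by
      simpa using ((tendsto_const_nhds (x := ν ^ 2)).div_atTop tendsto_id).neg
    refine tendsto_of_tendsto_of_tendsto_of_le_of_le' h0 tendsto_const_nhds ?_ ?_
    · filter_upwards [eventually_gt_atTop ν] with x hx
      have hx0 : 0 < x := hν.trans_lt hx
      have : x - ν ^ 2 / x ≤ Real.sqrt (x ^ 2 - ν ^ 2) := by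
        refine Real.le_sqrt_of_sq_le ?_
        have hle : ν ^ 2 / x ≤ x := by rw [div_le_iff₀ hx0]; nlinarith
        have hm : ν ^ 2 / x * x = ν ^ 2 := div_mul_cancel₀ _ hx0.ne'
        have hnn : 0 ≤ ν ^ 2 / x := by positivity
        nlinarith
      linarith
    · filter_upwards [eventually_gt_atTop 0] with x hx
      have : Real.sqrt (x ^ 2 - ν ^ 2) ≤ x := Real.sqrt_le_iff.2 ⟨hx.le, by nlinarith [sq_nonneg ν]⟩
      linarith
  have h2 : Tendsto (fun x => ν * Real.arccos (ν / x)) atTop (𝓝 (ν * (π / 2))) := by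
    have h := (Real.continuous_arccos.tendsto 0).comp
      ((tendsto_const_nhds (x := ν)).div_atTop tendsto_id)
    rw [Real.arccos_zero] at h
    exact h.const_mul ν
  have h := h1.sub h2
  rw [zero_sub, ← mul_div_assoc] at h
  exact h.congr fun x => by rw [debyePhase]; ring

/-- The difference, multiplied by `π`, of the two sides of the comparison. -/
noncomputable def phaseGap (ν x : ℝ) : ℝ := debyePhase ν x + π / 4 - shiftedPhase ν x

lemma sqrt_div_le_phaseDensity {ν x : ℝ} (hν : 0 ≤ ν) (hx : 0 < x) :
    Real.sqrt (x ^ 2 - ν ^ 2) / x ≤ 2 / π * phaseDensity ν x := by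
  have h := exp_sq_sub_mul_mod0_sq_le hν (Real.log x)
  rw [Real.exp_log hx, ← M2_eq hx] at h
  have hM := M2_pos ν hx
  have h1 : Real.sqrt (x ^ 2 - ν ^ 2) ≤ 2 / π / M2 ν x := by
    refine Real.sqrt_le_iff.2 ⟨by positivity, ?_⟩
    rw [div_pow, le_div_iff₀ (by positivity)]
    exact h
  rw [phaseDensity, div_le_iff₀ hx]
  refine h1.trans (le_of_eq ?_)
  field_simp

lemma antitoneOn_phaseGap {ν : ℝ} (hν : 0 ≤ ν) : AntitoneOn (phaseGap ν) (Ioi ν) := by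
  have hd : ∀ x ∈ Ioi ν, HasDerivAt (phaseGap ν)
      (Real.sqrt (x ^ 2 - ν ^ 2) / x - 2 / π * phaseDensity ν x) x := fun x hx =>
    ((hasDerivAt_debyePhase hν hx).add_const _).sub
      (hasDerivAt_shiftedPhase hν (hν.trans_lt hx))
  refine antitoneOn_of_deriv_nonpos (convex_Ioi ν)
    (fun x hx => (hd x hx).continuousAt.continuousWithinAt) ?_ ?_
  · rw [interior_Ioi]
    exact fun x hx => (hd x hx).differentiableAt.differentiableWithinAt
  · rw [interior_Ioi]
    intro x hx
    rw [(hd x hx).deriv]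
    have := sqrt_div_le_phaseDensity hν (hν.trans_lt hx)
    linarith

lemma phaseGap_nonneg_of_le_half {ν z : ℝ} (hν : 0 ≤ ν) (hν' : ν ≤ 1 / 2) (hz : ν < z) :
    0 ≤ phaseGap ν z := by
  have h := (tendsto_debyePhase_sub hν).add_const (ν * π / 2)
  rw [neg_add_cancel] at h
  refine le_of_tendsto h ?_
  filter_upwards [eventually_gt_atTop z] with x hx
  have h1 : phaseGap ν x ≤ phaseGap ν z := antitoneOn_phaseGap hν hz (hz.trans hx) hx.le
  have h2 := shiftedPhase_le hν hν' (hν.trans_lt (hz.trans hx))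
  rw [phaseGap] at h1
  linarith

lemma tendsto_cos_phaseGap {ν : ℝ} (hν : 1 / 2 ≤ ν) :
    Tendsto (fun x => cos (phaseGap ν x)) atTop (𝓝 1) := by
  have h1 := (tendsto_debyePhase_sub (ν := ν) (by linarith)).add_const (ν * π / 2)
  rw [neg_add_cancel] at h1
  have h2 := (Complex.continuous_exp.tendsto _).comp
    (((Complex.continuous_ofReal.tendsto _).comp h1).mul_const Complex.I)
  rw [Complex.ofReal_zero, zero_mul, Complex.exp_zero] at h2
  have h3 := h2.mul (tendsto_exp_sub_shiftedPhase hν)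
  rw [one_mul] at h3
  have h4 := (Complex.continuous_re.tendsto _).comp h3
  rw [Complex.one_re] at h4
  refine h4.congr fun x => ?_
  simp only [Function.comp_apply]
  rw [← Complex.exp_add, ← add_mul, ← Complex.ofReal_add, Complex.exp_ofReal_mul_I_re, phaseGap]
  ring_nf

lemma phaseGap_nonneg_of_eventually {ν z : ℝ} (hν : 1 / 2 ≤ ν) (hz : ν < z)
    (hlow : ∀ᶠ x in atTop, -π ≤ phaseGap ν x) : 0 ≤ phaseGap ν z := by
  by_contra! hneg
  have hle : ∀ᶠ x in atTop, cos (phaseGap ν x) ≤ cos (phaseGap ν z) := by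
    filter_upwards [hlow, eventually_ge_atTop z] with x hx hzx
    have h1 : phaseGap ν x ≤ phaseGap ν z :=
      antitoneOn_phaseGap (by linarith) hz (hz.trans_le hzx) hzx
    rw [← Real.cos_neg, ← Real.cos_neg (phaseGap ν z)]
    exact Real.cos_le_cos_of_nonneg_of_le_pi (by linarith) (by linarith) (by linarith)
  obtain ⟨x, hx, hzx⟩ := (hlow.and (eventually_ge_atTop z)).exists
  have h1 : phaseGap ν x ≤ phaseGap ν z :=
    antitoneOn_phaseGap (by linarith) hz (hz.trans_le hzx) hzx
  have h2 : cos (phaseGap ν z) < 1 := by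
    rw [← Real.cos_neg, ← Real.cos_zero]
    exact Real.cos_lt_cos_of_nonneg_of_le_pi le_rfl (by linarith) (by linarith)
  exact absurd (le_of_tendsto (tendsto_cos_phaseGap hν) hle) (not_le.2 h2)

lemma eventually_neg_pi_le_phaseGap {μ ν : ℝ} (hμ : 0 ≤ μ) (h : μ ≤ ν) (hν : ν ≤ μ + 1 / 2)
    (hgap : ∀ z, μ < z → 0 ≤ phaseGap μ z) : ∀ᶠ x in atTop, -π ≤ phaseGap ν x := by
  have hlim := (tendsto_debyePhase_sub (hμ.trans h)).sub (tendsto_debyePhase_sub hμ)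
  have hlt : -π < -(ν * π / 2) - -(μ * π / 2) := by nlinarith [Real.pi_pos]
  filter_upwards [hlim.eventually (eventually_gt_nhds hlt), eventually_gt_atTop μ] with x hx hμx
  have h1 := hgap x hμx
  have h2 := shiftedPhase_anti hμ h (hμ.trans_lt hμx)
  rw [phaseGap] at h1 ⊢
  linarith

lemma phaseGap_nonneg_of_le (n : ℕ) : ∀ ν : ℝ, 0 ≤ ν → ν ≤ (n + 1) / 2 → ∀ z, ν < z →
    0 ≤ phaseGap ν z := by
  induction n with
  | zero => exact fun ν hν hle z hz => phaseGap_nonneg_of_le_half hν (by simpa using hle) hz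
  | succ n ih =>
    intro ν hν hle z hz
    rcases le_total ν (1 / 2) with h | h
    · exact phaseGap_nonneg_of_le_half hν h hz
    · push_cast at hle
      refine phaseGap_nonneg_of_eventually h hz (eventually_neg_pi_le_phaseGap (μ := ν - 1 / 2)
        (by linarith) (by linarith) (by linarith) (ih _ (by linarith) (by linarith)))

lemma phaseGap_nonneg {ν z : ℝ} (hν : 0 ≤ ν) (hz : ν < z) : 0 ≤ phaseGap ν z := by
  refine phaseGap_nonneg_of_le ⌈2 * ν⌉₊ ν hν ?_ z hz
  have := Nat.le_ceil (2 * ν)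
  linarith

end BesselPhase

/-- For all `z > ν ≥ 0`, `B(z,ν) ≥ A(z,ν)`. -/
theorem A_le_B (z ν : ℝ) (hν : 0 ≤ ν) (hz : ν < z) : A z ν ≤ B z ν := by
  have h := BesselPhase.phaseGap_nonneg hν hz
  rw [BesselPhase.phaseGap, BesselPhase.debyePhase] at h
  have hπ := Real.pi_pos
  rw [A, B, BesselPhase.phase_eq, ← sub_nonneg]
  have : 1 / π * (Real.sqrt (z ^ 2 - ν ^ 2) - ν * Real.arccos (ν / z)) + 1 / 4 -
      1 / π * (-(π / 2) + BesselPhase.shiftedPhase ν z + π / 2) =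
      1 / π * (Real.sqrt (z ^ 2 - ν ^ 2) - ν * Real.arccos (ν / z) + π / 4 -
        BesselPhase.shiftedPhase ν z) := by
    field_simp
    ring
  rw [this]
  positivity
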